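/- arXiv:1712.05340 — 3 statements merged into one kernel-verified Lean document; each statement's English description precedes it below -/
import Mathlib

section
/- Let ε > 0 and let θ be a primitive random substitution on a finite alphabet 𝒜 with nonempty RS-subshift X_θ, such that θ is non-deterministic (i.e. |θ(a)| ≥ 2 for at least one letter a) and of minimum exponential growth. Then there exists a primitive random substitution θ̂ and a factor map f : X_{θ̂} → X_θ such that h_θ < h_{θ̂} < h_θ + ε. -/
namespace RS

variable {A : Type*} {V : Type*}

/-- The set of realisations of a random substitution applied (once) to a word. -/
def real (θ : A → Set (List A)) : List A → Set (List A)
  | [] => {[]}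
  | a :: w => {u | ∃ v ∈ θ a, ∃ r ∈ real θ w, u = v ++ r}

/-- The set of realisations of the `k`-th power of a random substitution on a word. -/
def realPow (θ : A → Set (List A)) : ℕ → List A → Set (List A)
  | 0, w => {w}
  | k + 1, w => ⋃ v ∈ real θ w, realPow θ k v

/-- `θ` is a random substitution: each letter has a nonempty finite set of
nonempty realisations. -/
def IsRandomSubst (θ : A → Set (List A)) : Prop :=
  ∀ a, (θ a).Nonempty ∧ (θ a).Finite ∧ ∀ u ∈ θ a, u ≠ []

/-- Primitivity of a random substitution. -/
def Primitive (θ : A → Set (List A)) : Prop :=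
  ∃ k : ℕ, ∀ a b : A, ∃ v ∈ realPow θ k [b], a ∈ v

/-- `θ`-legal words. -/
def Legal (θ : A → Set (List A)) (u : List A) : Prop :=
  ∃ (k : ℕ) (a : A) (v : List A), v ∈ realPow θ k [a] ∧ u <:+: v

/-- The subword of a bi-infinite sequence starting at `i` of length `n`. -/
def subwordAt (x : ℤ → A) (i : ℤ) (n : ℕ) : List A :=
  List.ofFn fun j : Fin n => x (i + (j : ℤ))

/-- The RS-subshift of a random substitution. -/
def X (θ : A → Set (List A)) : Set (ℤ → A) :=
  {x | ∀ (i : ℤ) (n : ℕ), Legal θ (subwordAt x i n)}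

/-- The left shift on bi-infinite sequences. -/
def shift (x : ℤ → A) : ℤ → A := fun i => x (i + 1)

/-- The words of length `n` in the language of a subshift. -/
def lang (Y : Set (ℤ → A)) (n : ℕ) : Set (List A) :=
  {u | u.length = n ∧ ∃ x ∈ Y, ∃ i : ℤ, u = subwordAt x i n}

/-- Topological entropy of a subshift. -/
noncomputable def entropy (Y : Set (ℤ → A)) : ℝ :=
  Filter.limsup (fun n : ℕ => Real.log ((lang Y n).ncard) / n) Filter.atTop

/-- Source of a list of edges. -/
def src (γ : List (V × V)) : Option V := γ.head?.map Prod.fst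

/-- Target of a list of edges. -/
def tgt (γ : List (V × V)) : Option V := γ.getLast?.map Prod.snd

/-- A (nonempty) path in the directed graph with edge set `E`. -/
def IsPath (E : Set (V × V)) (γ : List (V × V)) : Prop :=
  γ ≠ [] ∧ (∀ e ∈ γ, e ∈ E) ∧ γ.Chain' fun e f => e.2 = f.1

/-- A cycle: a path whose source equals its target. -/
def IsCycle (E : Set (V × V)) (γ : List (V × V)) : Prop :=
  IsPath E γ ∧ src γ = tgt γ

/-- A simple path/cycle: the sources of its edges are pairwise distinct. -/
def IsSimple (γ : List (V × V)) : Prop := (γ.map Prod.fst).Nodup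

/-- Strong connectivity. -/
def StronglyConnected (E : Set (V × V)) : Prop :=
  ∀ v w : V, ∃ γ : List (V × V), IsPath E γ ∧ src γ = some v ∧ tgt γ = some w

/-- The word read of a cycle: the sources of its edges followed by its root. -/
def wordRead (γ : List (V × V)) : List V :=
  γ.map Prod.fst ++ (src γ).toList

/-- The cycle-substitution associated with the graph on the alphabet `A`
with edge set `E`. -/
def cycleSubst (E : Set (A × A)) (a : A) : Set (List A) :=
  {[a]} ∪ {u | ∃ γ : List (A × A), IsCycle E γ ∧ IsSimple γ ∧ src γ = some a ∧ u = wordRead γ}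

/-- The word `w` applied under a deterministic substitution `φ`. -/
def detApply (φ : A → List A) (w : List A) : List A := (w.map φ).flatten

/-- Primitivity of a deterministic substitution. -/
def DetPrimitive (φ : A → List A) : Prop :=
  ∃ k : ℕ, ∀ a b : A, b ∈ (detApply φ)^[k] [a]

/-- The subshift of a deterministic substitution. -/
def Xdet (φ : A → List A) : Set (ℤ → A) :=
  {x | ∀ (i : ℤ) (n : ℕ), ∃ (k : ℕ) (a : A), subwordAt x i n <:+: (detApply φ)^[k] [a]}

/-- Substitutive subshifts. -/
def Substitutive (Y : Set (ℤ → A)) : Prop :=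
  ∃ φ : A → List A, (∀ a, φ a ≠ []) ∧ DetPrimitive φ ∧ Y = Xdet φ

/-- A factor map between subshifts. -/
def IsFactorMap {A B : Type*} [TopologicalSpace A] [TopologicalSpace B]
    (Y : Set (ℤ → A)) (Z : Set (ℤ → B)) (f : Y → Z) : Prop :=
  Continuous f ∧ Function.Surjective f ∧
    ∀ (x : ℤ → A) (hx : x ∈ Y) (hx' : shift x ∈ Y),
      ((f ⟨shift x, hx'⟩ : Z) : ℤ → B) = shift ((f ⟨x, hx⟩ : Z) : ℤ → B)

end RS

namespace RS

section Realisations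

variable {A : Type*} {θ : A → Set (List A)}

lemma mem_real_cons {a : A} {w v : List A} :
    v ∈ real θ (a :: w) ↔ ∃ x ∈ θ a, ∃ r ∈ real θ w, v = x ++ r := Iff.rfl

lemma mem_real_nil {v : List A} : v ∈ real θ [] ↔ v = [] := Iff.rfl

lemma mem_realPow_succ {k : ℕ} {w v : List A} :
    v ∈ realPow θ (k + 1) w ↔ ∃ y ∈ real θ w, v ∈ realPow θ k y := by
  simp [realPow]

lemma mem_realPow_zero {w v : List A} : v ∈ realPow θ 0 w ↔ v = w := Iff.rfl

lemma real_singleton (a : A) : real θ [a] = θ a := by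
  ext v
  simp [mem_real_cons, mem_real_nil]

lemma mem_real_append {w₁ w₂ v : List A} :
    v ∈ real θ (w₁ ++ w₂) ↔ ∃ v₁ ∈ real θ w₁, ∃ v₂ ∈ real θ w₂, v = v₁ ++ v₂ := by
  induction w₁ generalizing v with
  | nil => simp [mem_real_nil]
  | cons a w ih =>
    simp only [List.cons_append, mem_real_cons, ih]
    constructor
    · rintro ⟨x, hx, r, ⟨v₁, h₁, v₂, h₂, rfl⟩, rfl⟩
      exact ⟨x ++ v₁, ⟨x, hx, v₁, h₁, rfl⟩, v₂, h₂, by simp⟩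
    · rintro ⟨_, ⟨x, hx, v₁, h₁, rfl⟩, v₂, h₂, rfl⟩
      exact ⟨x, hx, v₁ ++ v₂, ⟨v₁, h₁, v₂, h₂, rfl⟩, by simp⟩

lemma mem_realPow_append {k : ℕ} {w₁ w₂ v : List A} :
    v ∈ realPow θ k (w₁ ++ w₂) ↔
      ∃ v₁ ∈ realPow θ k w₁, ∃ v₂ ∈ realPow θ k w₂, v = v₁ ++ v₂ := by
  induction k generalizing w₁ w₂ v with
  | zero => simp [mem_realPow_zero]
  | succ k ih =>
    simp only [mem_realPow_succ, mem_real_append]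
    constructor
    · rintro ⟨_, ⟨y₁, h₁, y₂, h₂, rfl⟩, hv⟩
      obtain ⟨v₁, g₁, v₂, g₂, rfl⟩ := ih.1 hv
      exact ⟨v₁, ⟨y₁, h₁, g₁⟩, v₂, ⟨y₂, h₂, g₂⟩, rfl⟩
    · rintro ⟨v₁, ⟨y₁, h₁, g₁⟩, v₂, ⟨y₂, h₂, g₂⟩, rfl⟩
      exact ⟨y₁ ++ y₂, ⟨y₁, h₁, y₂, h₂, rfl⟩, ih.2 ⟨v₁, g₁, v₂, g₂, rfl⟩⟩

lemma mem_realPow_add {j k : ℕ} {w v : List A} :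
    v ∈ realPow θ (j + k) w ↔ ∃ y ∈ realPow θ j w, v ∈ realPow θ k y := by
  induction j generalizing w with
  | zero => simp [mem_realPow_zero]
  | succ j ih =>
    rw [show j + 1 + k = (j + k) + 1 by ring]
    simp only [mem_realPow_succ, ih]
    constructor
    · rintro ⟨y, hy, z, hz, hv⟩
      exact ⟨z, ⟨y, hy, hz⟩, hv⟩
    · rintro ⟨z, ⟨y, hy, hz⟩, hv⟩
      exact ⟨y, hy, z, hz, hv⟩

lemma realPow_one (w : List A) : realPow θ 1 w = real θ w := by
  ext v
  simp [mem_realPow_succ, mem_realPow_zero]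

lemma mem_realPow_succ' {k : ℕ} {w v : List A} :
    v ∈ realPow θ (k + 1) w ↔ ∃ y ∈ realPow θ k w, v ∈ real θ y := by
  rw [mem_realPow_add]
  simp only [realPow_one]

lemma realPow_nil (k : ℕ) : realPow θ k [] = {[]} := by
  induction k with
  | zero => rfl
  | succ k ih =>
    ext v
    rw [mem_realPow_succ]
    simp [mem_real_nil, ih]

lemma real_nonempty (h : IsRandomSubst θ) (w : List A) : (real θ w).Nonempty := by
  induction w with
  | nil => exact ⟨[], rfl⟩
  | cons a w ih =>
    obtain ⟨x, hx⟩ := (h a).1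
    obtain ⟨r, hr⟩ := ih
    exact ⟨x ++ r, x, hx, r, hr, rfl⟩

lemma realPow_nonempty (h : IsRandomSubst θ) (k : ℕ) (w : List A) :
    (realPow θ k w).Nonempty := by
  induction k generalizing w with
  | zero => exact ⟨w, rfl⟩
  | succ k ih =>
    obtain ⟨y, hy⟩ := real_nonempty h w
    obtain ⟨v, hv⟩ := ih y
    exact ⟨v, mem_realPow_succ.2 ⟨y, hy, hv⟩⟩

lemma real_finite (h : IsRandomSubst θ) (w : List A) : (real θ w).Finite := by
  induction w with
  | nil => exact Set.finite_singleton _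
  | cons a w ih =>
    refine (Set.Finite.image2 (fun x r => x ++ r) (h a).2.1 ih).subset ?_
    rintro _ ⟨x, hx, r, hr, rfl⟩
    exact ⟨x, hx, r, hr, rfl⟩

lemma realPow_finite (h : IsRandomSubst θ) (k : ℕ) (w : List A) :
    (realPow θ k w).Finite := by
  induction k generalizing w with
  | zero => exact Set.finite_singleton _
  | succ k ih => exact (real_finite h w).biUnion fun v _ => ih v

lemma length_le_of_mem_real (h : IsRandomSubst θ) {w v : List A} (hv : v ∈ real θ w) :
    w.length ≤ v.length := by
  induction w generalizing v with
  | nil => simp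
  | cons a w ih =>
    obtain ⟨x, hx, r, hr, rfl⟩ := hv
    have := ih hr
    have := List.length_pos_iff.2 ((h a).2.2 x hx)
    simp only [List.length_cons, List.length_append]
    omega

lemma length_le_of_mem_realPow (h : IsRandomSubst θ) {k : ℕ} {w v : List A}
    (hv : v ∈ realPow θ k w) : w.length ≤ v.length := by
  induction k generalizing w with
  | zero => rw [mem_realPow_zero.1 hv]
  | succ k ih =>
    obtain ⟨y, hy, hv⟩ := mem_realPow_succ.1 hv
    exact (length_le_of_mem_real h hy).trans (ih hv)

lemma exists_extend_realPow (h : IsRandomSubst θ) {k : ℕ} (w₁ w₂ : List A) {w v : List A}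
    (hv : v ∈ realPow θ k w) :
    ∃ v₁ ∈ realPow θ k w₁, ∃ v₂ ∈ realPow θ k w₂,
      v₁ ++ (v ++ v₂) ∈ realPow θ k (w₁ ++ (w ++ w₂)) := by
  obtain ⟨v₁, h₁⟩ := realPow_nonempty h k w₁
  obtain ⟨v₂, h₂⟩ := realPow_nonempty h k w₂
  exact ⟨v₁, h₁, v₂, h₂,
    mem_realPow_append.2 ⟨_, h₁, _, mem_realPow_append.2 ⟨_, hv, _, h₂, rfl⟩, rfl⟩⟩

lemma Primitive.eventually (h : IsRandomSubst θ) (hp : Primitive θ) :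
    ∃ p : ℕ, ∀ s, p ≤ s → ∀ a b : A, ∃ v ∈ realPow θ s [b], a ∈ v := by
  obtain ⟨p, hp⟩ := hp
  refine ⟨p, fun s hs a b => ?_⟩
  obtain ⟨d, rfl⟩ := Nat.exists_eq_add_of_le' hs
  obtain ⟨y, hy⟩ := realPow_nonempty h d [b]
  obtain ⟨c, y', rfl⟩ : ∃ c y', y = c :: y' := by
    cases y with
    | nil => simpa using length_le_of_mem_realPow h hy
    | cons c y' => exact ⟨c, y', rfl⟩
  obtain ⟨v, hv, hav⟩ := hp a c
  obtain ⟨v₁, -, v₂, -, hmem⟩ := exists_extend_realPow h [] y' hv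
  exact ⟨_, mem_realPow_add.2 ⟨_, hy, hmem⟩, by simp [hav]⟩

lemma Legal.of_infix {u v : List A} (hv : Legal θ v) (huv : u <:+: v) : Legal θ u := by
  obtain ⟨k, a, w, hw, hvw⟩ := hv
  exact ⟨k, a, w, hw, huv.trans hvw⟩

/-- The `N`-th power of a random substitution, as a random substitution. -/
def powSubst (θ : A → Set (List A)) (N : ℕ) (a : A) : Set (List A) := realPow θ N [a]

lemma real_powSubst (N : ℕ) (w : List A) : real (powSubst θ N) w = realPow θ N w := by
  induction w with
  | nil => rw [realPow_nil]; rfl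
  | cons a w ih =>
    ext v
    rw [mem_real_cons, ih, ← List.singleton_append, mem_realPow_append]
    rfl

lemma realPow_powSubst (N k : ℕ) (w : List A) :
    realPow (powSubst θ N) k w = realPow θ (N * k) w := by
  induction k generalizing w with
  | zero => rfl
  | succ k ih =>
    ext v
    rw [mem_realPow_succ, Nat.mul_succ, Nat.add_comm, mem_realPow_add]
    simp only [real_powSubst, ih]

lemma isRandomSubst_powSubst (h : IsRandomSubst θ) (N : ℕ) :
    IsRandomSubst (powSubst θ N) := fun a =>
  ⟨realPow_nonempty h N _, realPow_finite h N _, fun u hu hnil => by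
    simpa [hnil] using length_le_of_mem_realPow h hu⟩

lemma primitive_powSubst (h : IsRandomSubst θ) (hp : Primitive θ) {N : ℕ} (hN : 1 ≤ N) :
    Primitive (powSubst θ N) := by
  obtain ⟨p, hp⟩ := hp.eventually h
  refine ⟨p, fun a b => ?_⟩
  rw [realPow_powSubst]
  exact hp _ (Nat.le_mul_of_pos_left p hN) a b

lemma legal_of_legal_powSubst {N : ℕ} {u : List A} (hu : Legal (powSubst θ N) u) :
    Legal θ u := by
  obtain ⟨k, a, v, hv, huv⟩ := hu
  exact ⟨N * k, a, v, by rwa [realPow_powSubst] at hv, huv⟩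

lemma Legal.exists_powSubst (h : IsRandomSubst θ) (hp : Primitive θ) {N : ℕ} (hN : 1 ≤ N)
    {u : List A} (hu : Legal θ u) :
    ∃ (j : ℕ) (a : A), ∃ w ∈ realPow (powSubst θ N) j [a], ∃ v ∈ real (powSubst θ N) w,
      u <:+: v := by
  obtain ⟨k, a, v, hv, huv⟩ := hu
  obtain ⟨p, hp⟩ := hp.eventually h
  have hle : k + p ≤ N * (k + p + 1) := by nlinarith
  obtain ⟨s, hs⟩ := Nat.exists_eq_add_of_le hle
  obtain ⟨y, hy, hay⟩ := hp (p + s) (Nat.le_add_right _ _) a a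
  obtain ⟨y₁, y₂, rfl⟩ := List.append_of_mem hay
  obtain ⟨v₁, -, v₂, -, hmem⟩ := exists_extend_realPow h y₁ y₂ hv
  have hmem' : v₁ ++ (v ++ v₂) ∈ realPow (powSubst θ N) (k + p + 1) [a] := by
    rw [realPow_powSubst, hs, show k + p + s = (p + s) + k by ring]
    exact mem_realPow_add.2 ⟨_, hy, hmem⟩
  obtain ⟨w, hw, hvw⟩ := mem_realPow_succ'.1 hmem'
  exact ⟨_, a, w, hw, _, hvw, huv.trans (List.infix_append' _ _ _)⟩

lemma Legal.exists_extend (h : IsRandomSubst θ) (hp : Primitive θ)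
    (hlong : ∀ a, ∃ v ∈ θ a, 3 ≤ v.length) {u : List A} (hu : Legal θ u) :
    ∃ c d, Legal θ (c :: (u ++ [d])) := by
  obtain ⟨k, a, v, hv, s, t, rfl⟩ := hu
  obtain ⟨p, hp⟩ := hp.eventually h
  obtain ⟨y, hy, hlen⟩ := hlong a
  obtain ⟨y₁, y₂, y₃, y', rfl⟩ : ∃ y₁ y₂ y₃ y', y = y₁ :: y₂ :: y₃ :: y' := by
    match y, hlen with
    | y₁ :: y₂ :: y₃ :: y', _ => exact ⟨y₁, y₂, y₃, y', rfl⟩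
  obtain ⟨z, hz, haz⟩ := hp p le_rfl a y₂
  obtain ⟨z₁, z₂, rfl⟩ := List.append_of_mem haz
  have hz' : z₁ ++ ([a] ++ z₂) ∈ realPow θ p [y₂] := by simpa using hz
  have hv' : ∃ v₁ v₂, v₁ ++ ((s ++ u ++ t) ++ v₂) ∈ realPow θ (p + k) [y₂] := by
    obtain ⟨v₁, -, v₂, -, hmem⟩ := exists_extend_realPow h z₁ z₂ hv
    exact ⟨v₁, v₂, mem_realPow_add.2 ⟨_, hz', hmem⟩⟩
  obtain ⟨v₁, v₂, hv'⟩ := hv'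
  obtain ⟨x₁, hx₁, x₂, hx₂, hmem⟩ := exists_extend_realPow h [y₁] (y₃ :: y') hv'
  have hx₁' : x₁ ≠ [] := fun h0 => by simpa [h0] using length_le_of_mem_realPow h hx₁
  have hx₂' : x₂ ≠ [] := fun h0 => by simpa [h0] using length_le_of_mem_realPow h hx₂
  obtain ⟨l, c, hl⟩ := List.eq_nil_or_concat (x₁ ++ v₁ ++ s) |>.resolve_left (by simp [hx₁'])
  obtain ⟨d, r, hr⟩ := List.exists_cons_of_ne_nil (l := t ++ v₂ ++ x₂) (by simp [hx₂'])
  refine ⟨c, d, 1 + (p + k), a, _, mem_realPow_add.2 ⟨y₁ :: y₂ :: y₃ :: y', ?_, hmem⟩, l, r, ?_⟩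
  · rwa [realPow_one, real_singleton]
  · calc l ++ c :: (u ++ [d]) ++ r = (l ++ [c]) ++ u ++ (d :: r) := by simp
      _ = x₁ ++ (v₁ ++ (s ++ u ++ t ++ v₂) ++ x₂) := by
        rw [← hr]
        simp only [List.concat_eq_append] at hl
        rw [← hl]
        simp

end Realisations

section Subshift

variable {A : Type*} {θ : A → Set (List A)}

lemma length_subwordAt (x : ℤ → A) (i : ℤ) (n : ℕ) : (subwordAt x i n).length = n := by
  simp [subwordAt]

lemma map_subwordAt {B : Type*} (f : A → B) (x : ℤ → A) (i : ℤ) (n : ℕ) :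
    (subwordAt x i n).map f = subwordAt (fun j => f (x j)) i n := by
  simp [subwordAt, List.map_ofFn, Function.comp_def]

lemma subwordAt_add (x : ℤ → A) (i : ℤ) (m n : ℕ) :
    subwordAt x i (m + n) = subwordAt x i m ++ subwordAt x (i + m) n := by
  simp [subwordAt, List.ofFn_add, add_assoc]

lemma exists_mem_X_of_legal
    (hext : ∀ u, Legal θ u → ∃ c d, Legal θ (c :: (u ++ [d]))) {u : List A}
    (hu : Legal θ u) : ∃ x ∈ X θ, u = subwordAt x 0 u.length := by
  have : Nonempty A := hu.elim fun _ ⟨a, _⟩ => ⟨a⟩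
  choose! c d hcd using hext
  obtain ⟨F, hF₀, hF⟩ : ∃ F : ℕ → List A, F 0 = u ∧
      ∀ k, F (k + 1) = c (F k) :: (F k ++ [d (F k)]) :=
    ⟨fun k => Nat.rec u (fun _ w => c w :: (w ++ [d w])) k, rfl, fun _ => rfl⟩
  have hlegal : ∀ k, Legal θ (F k) := by
    intro k
    induction k with
    | zero => rwa [hF₀]
    | succ k ih => rw [hF]; exact hcd _ ih
  have hlen : ∀ k, (F k).length = u.length + 2 * k := by
    intro k
    induction k with
    | zero => simp [hF₀]
    | succ k ih => rw [hF]; simp [ih]; ring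
  have hstable : ∀ k l j, j < (F k).length → (F (k + l))[j + l]? = (F k)[j]? := by
    intro k l j hj
    induction l with
    | zero => rfl
    | succ l ih =>
      rw [← add_assoc, ← add_assoc, hF, List.getElem?_cons_succ, List.getElem?_append_left, ih]
      rw [hlen] at hj ⊢
      omega
  let x : ℤ → A := fun i => ((F (i.natAbs + 1))[(i + (i.natAbs + 1 : ℕ)).toNat]?).getD (c u)
  have hx : ∀ (k : ℕ) (i : ℤ), 0 ≤ i + k → i + k < u.length + 2 * k →
      (F k)[(i + k).toNat]? = some (x i) := by
    intro k i h₀ h₁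
    have hj : (i + (i.natAbs + 1 : ℕ)).toNat < (F (i.natAbs + 1)).length := by
      rw [hlen]; omega
    have hxi : (F (i.natAbs + 1))[(i + (i.natAbs + 1 : ℕ)).toNat]? = some (x i) := by
      simp only [x, List.getElem?_eq_getElem hj, Option.getD_some]
    have hk : (i + k).toNat < (F k).length := by rw [hlen]; omega
    rw [← hstable k (i.natAbs + 1) _ hk, ← hxi, ← hstable (i.natAbs + 1) k _ hj, add_comm k]
    congr 1
    omega
  have hsub : ∀ k : ℕ, F k = subwordAt x (-k) (u.length + 2 * k) := by
    intro k
    apply List.ext_getElem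
    · rw [hlen, length_subwordAt]
    · intro j h₁ h₂
      rw [hlen] at h₁
      have := hx k (-k + j) (by omega) (by omega)
      rw [show (-(k : ℤ) + j + k).toNat = j by omega, List.getElem?_eq_getElem (by rwa [hlen]),
        Option.some_inj] at this
      simpa [subwordAt] using this
  refine ⟨x, fun i n => ?_, by simpa [hF₀] using hsub 0⟩
  refine (hlegal (i.natAbs + n)).of_infix ?_
  obtain ⟨p, hp⟩ : ∃ p : ℕ, i = -((i.natAbs + n : ℕ) : ℤ) + p :=
    ⟨(i + (i.natAbs + n : ℕ)).toNat, by omega⟩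
  obtain ⟨q, hq⟩ : ∃ q : ℕ, u.length + 2 * (i.natAbs + n) = p + n + q :=
    Nat.exists_eq_add_of_le (by omega)
  rw [hsub, hq, subwordAt_add, subwordAt_add, ← hp]
  exact List.infix_append _ _ _

lemma lang_finite [Finite A] (Y : Set (ℤ → A)) (n : ℕ) : (lang Y n).Finite :=
  (List.finite_length_eq A n).subset fun _ hu => hu.1

lemma ncard_lang_le [Fintype A] (Y : Set (ℤ → A)) (n : ℕ) :
    (lang Y n).ncard ≤ Fintype.card A ^ n := by
  have h : ({l : List A | l.length = n}).ncard = Fintype.card A ^ n := by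
    rw [← card_vector, ← Nat.card_eq_fintype_card]
    rfl
  rw [← h]
  exact Set.ncard_le_ncard (fun _ hu => hu.1) (List.finite_length_eq A n)

lemma ncard_lang_pos [Finite A] {Y : Set (ℤ → A)} (hY : Y.Nonempty) (n : ℕ) :
    0 < (lang Y n).ncard := by
  obtain ⟨x, hx⟩ := hY
  exact (Set.ncard_pos (lang_finite Y n)).2
    ⟨subwordAt x 0 n, length_subwordAt _ _ _, x, hx, 0, rfl⟩

lemma log_ncard_lang_div_le [Fintype A] {Y : Set (ℤ → A)} (hY : Y.Nonempty) (n : ℕ) :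
    Real.log ((lang Y n).ncard) / n ≤ Real.log (Fintype.card A) := by
  rcases Nat.eq_zero_or_pos n with rfl | hn
  · simpa using Real.log_natCast_nonneg _
  rw [div_le_iff₀ (by exact_mod_cast hn), mul_comm, ← Real.log_pow]
  apply Real.log_le_log (by exact_mod_cast ncard_lang_pos hY n)
  exact_mod_cast ncard_lang_le Y n

lemma limsup_add_le_limsup {a b : ℕ → ℝ} {K c : ℝ} (ha₀ : ∀ n, 0 ≤ a n) (haK : ∀ n, a n ≤ K)
    (hbK : ∀ n, b n ≤ K) (hab : ∀ᶠ n in Filter.atTop, a n + c ≤ b n) :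
    Filter.limsup a Filter.atTop + c ≤ Filter.limsup b Filter.atTop := by
  have hbdd : Filter.IsBoundedUnder (· ≤ ·) Filter.atTop a :=
    Filter.isBoundedUnder_of ⟨K, haK⟩
  have hcob : Filter.IsCoboundedUnder (· ≤ ·) Filter.atTop a :=
    (Filter.isBoundedUnder_of ⟨0, ha₀⟩).isCoboundedUnder_flip
  rw [← limsup_add_const Filter.atTop a c hbdd hcob]
  refine Filter.limsup_le_limsup hab ?_ ?_
  · exact (Filter.isBoundedUnder_of (r := (· ≥ ·)) (f := Filter.atTop)
      ⟨0 + c, fun n => by simpa using ha₀ n⟩ :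
        Filter.IsBoundedUnder (· ≥ ·) Filter.atTop fun n => a n + c).isCoboundedUnder_flip
  · exact Filter.isBoundedUnder_of ⟨K, hbK⟩

end Subshift

end RS

namespace RS

lemma prefix_or_exists_of_prefix_append {A : Type*} {l xs ys : List A} (h : l <+: xs ++ ys) :
    l <+: xs ∨ ∃ l', l = xs ++ l' ∧ l' <+: ys := by
  obtain ⟨t, ht⟩ := h
  rcases List.append_eq_append_iff.1 ht with ⟨as, h, -⟩ | ⟨bs, h, h'⟩
  · exact .inl ⟨as, h.symm⟩
  · exact .inr ⟨bs, h, t, h'.symm⟩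

section Marking

variable {A B : Type*} {φ : A → Set (List A)}

/-- The random substitution on marked letters whose realisations are those of `φ` with at most
one marked letter, irrespective of the mark on the letter it is applied to. -/
def marked (e : B ≃ A × Bool) (φ : A → Set (List A)) (b : B) : Set (List B) :=
  {v | v.map (fun c => (e c).1) ∈ φ (e b).1 ∧ v.countP (fun c => (e c).2) ≤ 1}

variable {e : B ≃ A × Bool}

lemma map_fst_map_symm (i : Bool) (v : List A) :
    (v.map fun a => e.symm (a, i)).map (fun c => (e c).1) = v := by
  simp [Function.comp_def]

lemma countP_map_symm_false (v : List A) :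
    (v.map fun a => e.symm (a, false)).countP (fun c => (e c).2) = 0 := by
  simp [List.countP_eq_zero]

lemma map_symm_false_mem_marked {a : A} {b : B} {v : List A} (hv : v ∈ φ a)
    (hb : (e b).1 = a) : (v.map fun a => e.symm (a, false)) ∈ marked e φ b := by
  refine ⟨?_, ?_⟩
  · rwa [map_fst_map_symm, hb]
  · rw [countP_map_symm_false]
    exact zero_le_one

lemma mark_mem_marked {a c : A} {b : B} {v₁ v₂ : List A} (i : Bool)
    (hv : v₁ ++ c :: v₂ ∈ φ a) (hb : (e b).1 = a) :
    (v₁.map fun a => e.symm (a, false)) ++ e.symm (c, i) ::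
      (v₂.map fun a => e.symm (a, false)) ∈ marked e φ b := by
  refine ⟨?_, ?_⟩
  · simp only [List.map_append, List.map_cons, map_fst_map_symm, Equiv.apply_symm_apply]
    rwa [hb]
  · rw [List.countP_append, List.countP_cons, countP_map_symm_false, countP_map_symm_false]
    cases i <;> simp

lemma isRandomSubst_marked [Finite A] (h : IsRandomSubst φ) :
    IsRandomSubst (marked e φ) := by
  intro b
  obtain ⟨v, hv⟩ := (h (e b).1).1
  refine ⟨⟨_, map_symm_false_mem_marked hv rfl⟩, ?_, ?_⟩
  · have : Finite B := Finite.of_equiv _ e.symm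
    obtain ⟨M, hM⟩ := ((h (e b).1).2.1.image List.length).bddAbove
    refine (List.finite_length_le B M).subset fun v hv => ?_
    simpa using hM ⟨_, hv.1, rfl⟩
  · rintro _ hv rfl
    exact (h _).2.2 _ hv.1 rfl

lemma map_fst_mem_real {w v : List B} (hv : v ∈ real (marked e φ) w) :
    v.map (fun c => (e c).1) ∈ real φ (w.map fun c => (e c).1) := by
  induction w generalizing v with
  | nil => rw [mem_real_nil.1 hv]; rfl
  | cons b w ih =>
    obtain ⟨x, hx, r, hr, rfl⟩ := hv
    exact ⟨_, hx.1, _, ih hr, by simp⟩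

lemma map_fst_mem_realPow {k : ℕ} {w v : List B} (hv : v ∈ realPow (marked e φ) k w) :
    v.map (fun c => (e c).1) ∈ realPow φ k (w.map fun c => (e c).1) := by
  induction k generalizing w with
  | zero => rw [mem_realPow_zero.1 hv]; rfl
  | succ k ih =>
    obtain ⟨y, hy, hv⟩ := mem_realPow_succ.1 hv
    exact mem_realPow_succ.2 ⟨_, map_fst_mem_real hy, ih hv⟩

lemma Legal.map_fst {u : List B} (hu : Legal (marked e φ) u) :
    Legal φ (u.map fun c => (e c).1) := by
  obtain ⟨k, b, v, hv, huv⟩ := hu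
  exact ⟨k, (e b).1, _, map_fst_mem_realPow hv, huv.map _⟩

lemma map_symm_false_mem_real {w : List B} {v : List A}
    (hv : v ∈ real φ (w.map fun c => (e c).1)) :
    (v.map fun a => e.symm (a, false)) ∈ real (marked e φ) w := by
  induction w generalizing v with
  | nil => rw [mem_real_nil.1 hv]; rfl
  | cons b w ih =>
    obtain ⟨x, hx, r, hr, rfl⟩ := hv
    exact ⟨_, map_symm_false_mem_marked hx rfl, _, ih hr, by simp⟩

lemma exists_mem_realPow_marked {k : ℕ} {w : List B} {v : List A}
    (hv : v ∈ realPow φ k (w.map fun c => (e c).1)) :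
    ∃ v' ∈ realPow (marked e φ) k w, v'.map (fun c => (e c).1) = v := by
  induction k generalizing w with
  | zero => exact ⟨w, rfl, hv.symm⟩
  | succ k ih =>
    obtain ⟨y, hy, hv⟩ := mem_realPow_succ.1 hv
    rw [← map_fst_map_symm (e := e) false y] at hv
    obtain ⟨v', hv', h⟩ := ih hv
    exact ⟨v', mem_realPow_succ.2 ⟨_, map_symm_false_mem_real hy, hv'⟩, h⟩

lemma Legal.map_symm_false {u : List A} (hu : Legal φ u) :
    Legal (marked e φ) (u.map fun a => e.symm (a, false)) := by
  obtain ⟨k, a, v, hv, huv⟩ := hu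
  suffices h : ∀ w, v ∈ realPow φ k w → (v.map fun a => e.symm (a, false)) ∈
      realPow (marked e φ) k (w.map fun a => e.symm (a, false)) from
    ⟨k, e.symm (a, false), _, h [a] hv, huv.map _⟩
  clear hv huv
  induction k with
  | zero => rintro w rfl; rfl
  | succ k ih =>
    intro w hv
    obtain ⟨y, hy, hv⟩ := mem_realPow_succ.1 hv
    refine mem_realPow_succ.2 ⟨_, ?_, ih y hv⟩
    exact map_symm_false_mem_real (by rwa [map_fst_map_symm])

lemma exists_mark_mem_real {w : List B} {v : List A} {a : A} (i : Bool)
    (hv : v ∈ real φ (w.map fun c => (e c).1)) (ha : a ∈ v) :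
    ∃ v' ∈ real (marked e φ) w, e.symm (a, i) ∈ v' := by
  induction w generalizing v with
  | nil => simp [mem_real_nil.1 hv] at ha
  | cons b w ih =>
    obtain ⟨x, hx, r, hr, rfl⟩ := hv
    rcases List.mem_append.1 ha with ha | ha
    · obtain ⟨x₁, x₂, rfl⟩ := List.append_of_mem ha
      exact ⟨_, ⟨_, mark_mem_marked i hx rfl, _, map_symm_false_mem_real hr, rfl⟩, by simp⟩
    · obtain ⟨r', hr', h⟩ := ih hr ha
      exact ⟨_, ⟨_, map_symm_false_mem_marked hx rfl, _, hr', rfl⟩,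
        List.mem_append_right _ h⟩

lemma primitive_marked (h : IsRandomSubst φ) (hp : Primitive φ) :
    Primitive (marked e φ) := by
  obtain ⟨p, hp⟩ := hp.eventually h
  refine ⟨p + 1, fun a b => ?_⟩
  obtain ⟨v, hv, hav⟩ := hp (p + 1) (Nat.le_succ p) (e a).1 (e b).1
  obtain ⟨w, hw, hv⟩ := mem_realPow_succ'.1 hv
  obtain ⟨w', hw', rfl⟩ := exists_mem_realPow_marked (e := e) (w := [b]) hw
  obtain ⟨v', hv', ha⟩ := exists_mark_mem_real (e a).2 hv hav
  exact ⟨v', mem_realPow_succ'.2 ⟨w', hw', hv'⟩, by simpa using ha⟩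

lemma countP_le_of_prefix {L : ℕ} (hL : ∀ a, ∀ v ∈ φ a, L ≤ v.length) {w u v : List B}
    (hv : v ∈ real (marked e φ) w) (hu : u <+: v) :
    L * u.countP (fun c => (e c).2) ≤ u.length + L := by
  induction w generalizing u v with
  | nil =>
    rw [mem_real_nil.1 hv, List.prefix_nil] at hu
    simp [hu]
  | cons b w ih =>
    obtain ⟨x, hx, r, hr, rfl⟩ := hv
    rcases prefix_or_exists_of_prefix_append hu with hu | ⟨u', rfl, hu'⟩
    · have := (hu.sublist.countP_le (p := fun c => (e c).2)).trans hx.2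
      nlinarith
    · have := ih hr hu'
      have h₁ := hL _ _ hx.1
      rw [List.length_map] at h₁
      rw [List.countP_append, List.length_append]
      nlinarith [hx.2]

lemma countP_le_of_infix {L : ℕ} (hL : ∀ a, ∀ v ∈ φ a, L ≤ v.length) {w u v : List B}
    (hv : v ∈ real (marked e φ) w) (hu : u <:+: v) :
    L * u.countP (fun c => (e c).2) ≤ u.length + 2 * L := by
  induction w generalizing u v with
  | nil =>
    rw [mem_real_nil.1 hv, List.infix_nil] at hu
    simp [hu]
  | cons b w ih =>
    obtain ⟨x, hx, r, hr, rfl⟩ := hv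
    rcases List.infix_append_iff.1 hu with hu | hu | ⟨s, u', rfl, hs, hu'⟩
    · have := (hu.sublist.countP_le (p := fun c => (e c).2)).trans hx.2
      nlinarith
    · exact ih hr hu
    · have := countP_le_of_prefix hL hr hu'
      have := (hs.sublist.countP_le (p := fun c => (e c).2)).trans hx.2
      rw [List.countP_append, List.length_append]
      nlinarith

lemma Legal.countP_le {L : ℕ} (hL : ∀ a, ∀ v ∈ φ a, L ≤ v.length) {u : List B}
    (hu : Legal (marked e φ) u) :
    L * u.countP (fun c => (e c).2) ≤ u.length + 2 * L := by
  obtain ⟨k, b, v, hv, huv⟩ := hu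
  cases k with
  | zero =>
    rw [mem_realPow_zero.1 hv] at huv
    have h₁ : u.length ≤ 1 := by simpa using huv.length_le
    have h₂ := List.countP_le_length (l := u) (p := fun c => (e c).2)
    nlinarith
  | succ k =>
    obtain ⟨y, -, hv⟩ := mem_realPow_succ'.1 hv
    exact countP_le_of_infix hL hv huv

lemma exists_lifts_of_prefix [DecidableEq B] (h : IsRandomSubst φ) {M : ℕ}
    (hM : ∀ a, ∀ v ∈ φ a, v.length ≤ M) {w u v : List A} (hv : v ∈ real φ w) (hu : u <+: v) :
    ∃ (k : ℕ) (S : Finset (List B)), u.length ≤ M * (k + 1) ∧ 2 ^ k ≤ S.card ∧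
      ∀ u' ∈ S, u'.map (fun c => (e c).1) = u ∧
        ∃ v' ∈ real (marked e φ) (w.map fun a => e.symm (a, false)), u' <+: v' := by
  induction w generalizing u v with
  | nil =>
    rw [mem_real_nil.1 hv, List.prefix_nil] at hu
    exact ⟨0, {[]}, by simp [hu], by simp, by simp [hu, mem_real_nil]⟩
  | cons a w ih =>
    obtain ⟨x, hx, r, hr, rfl⟩ := hv
    have hx₀ : (x.map fun a => e.symm (a, false)) ∈ marked e φ (e.symm (a, false)) :=
      map_symm_false_mem_marked hx (by simp)
    rcases prefix_or_exists_of_prefix_append hu with hu | ⟨u', rfl, hu'⟩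
    · refine ⟨0, {u.map fun a => e.symm (a, false)}, ?_, by simp, ?_⟩
      · simpa using hu.length_le.trans (hM _ _ hx)
      · simp only [Finset.mem_singleton, forall_eq, map_fst_map_symm, true_and]
        have hr' := map_symm_false_mem_real (e := e) (v := r)
          (w := w.map fun a => e.symm (a, false)) (by rwa [map_fst_map_symm])
        exact ⟨_, ⟨_, hx₀, _, hr', rfl⟩, List.prefix_append_of_prefix (hu.map _)⟩
    · obtain ⟨k, S, hk, hS, hS'⟩ := ih hr hu'
      obtain ⟨c, x', rfl⟩ := List.exists_cons_of_ne_nil ((h a).2.2 x hx)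
      set x₀ := (c :: x').map fun a => e.symm (a, false) with hx₀_def
      set x₁ := e.symm (c, true) :: x'.map fun a => e.symm (a, false) with hx₁_def
      have hx₁ : x₁ ∈ marked e φ (e.symm (a, false)) :=
        mark_mem_marked (v₁ := []) true hx (by simp)
      have hdisj : Disjoint (S.image (x₀ ++ ·)) (S.image (x₁ ++ ·)) := by
        rw [Finset.disjoint_left]
        intro y hy₀ hy₁
        obtain ⟨s, -, rfl⟩ := Finset.mem_image.1 hy₀
        obtain ⟨t, -, h⟩ := Finset.mem_image.1 hy₁
        simp [hx₀_def, hx₁_def] at h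
      refine ⟨k + 1, S.image (x₀ ++ ·) ∪ S.image (x₁ ++ ·), ?_, ?_, ?_⟩
      · have := hM _ _ hx
        rw [List.length_append]
        nlinarith
      · rw [Finset.card_union_of_disjoint hdisj,
          Finset.card_image_of_injective _ (List.append_right_injective _),
          Finset.card_image_of_injective _ (List.append_right_injective _), pow_succ]
        omega
      · intro y hy
        rw [Finset.mem_union, Finset.mem_image, Finset.mem_image] at hy
        rcases hy with ⟨s, hs, rfl⟩ | ⟨s, hs, rfl⟩ <;> obtain ⟨h₁, v', hv', hsv⟩ := hS' s hs
        · refine ⟨by simp [hx₀_def, h₁, Function.comp_def], _, ⟨_, hx₀, _, hv', rfl⟩, ?_⟩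
          exact (List.prefix_append_right_inj _).2 hsv
        · refine ⟨by simp [hx₁_def, h₁, Function.comp_def], _, ⟨_, hx₁, _, hv', rfl⟩, ?_⟩
          exact (List.prefix_append_right_inj _).2 hsv

lemma exists_lifts_of_infix [DecidableEq B] (h : IsRandomSubst φ) {M : ℕ}
    (hM : ∀ a, ∀ v ∈ φ a, v.length ≤ M) {w u v : List A} (hv : v ∈ real φ w) (hu : u <:+: v) :
    ∃ (k : ℕ) (S : Finset (List B)), u.length ≤ M * (k + 2) ∧ 2 ^ k ≤ S.card ∧
      ∀ u' ∈ S, u'.map (fun c => (e c).1) = u ∧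
        ∃ v' ∈ real (marked e φ) (w.map fun a => e.symm (a, false)), u' <:+: v' := by
  induction w generalizing u v with
  | nil =>
    rw [mem_real_nil.1 hv, List.infix_nil] at hu
    exact ⟨0, {[]}, by simp [hu], by simp, by simp [hu, mem_real_nil]⟩
  | cons a w ih =>
    obtain ⟨x, hx, r, hr, rfl⟩ := hv
    have hx₀ : (x.map fun a => e.symm (a, false)) ∈ marked e φ (e.symm (a, false)) :=
      map_symm_false_mem_marked hx (by simp)
    have hxM := hM _ _ hx
    rcases List.infix_append_iff.1 hu with hu | hu | ⟨s, u', rfl, hs, hu'⟩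
    · refine ⟨0, {u.map fun a => e.symm (a, false)}, ?_, by simp, ?_⟩
      · have := hu.length_le
        omega
      · simp only [Finset.mem_singleton, forall_eq, map_fst_map_symm, true_and]
        have hr' := map_symm_false_mem_real (e := e) (v := r)
          (w := w.map fun a => e.symm (a, false)) (by rwa [map_fst_map_symm])
        exact ⟨_, ⟨_, hx₀, _, hr', rfl⟩,
          (hu.map _).trans (List.prefix_append _ _).isInfix⟩
    · obtain ⟨k, S, hk, hS, hS'⟩ := ih hr hu
      refine ⟨k, S, hk, hS, fun y hy => ?_⟩
      obtain ⟨h₁, v', hv', hsv⟩ := hS' y hy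
      exact ⟨h₁, _, ⟨_, hx₀, _, hv', rfl⟩, hsv.trans (List.suffix_append _ _).isInfix⟩
    · obtain ⟨k, S, hk, hS, hS'⟩ := exists_lifts_of_prefix (e := e) h hM hr hu'
      refine ⟨k, S.image ((s.map fun a => e.symm (a, false)) ++ ·), ?_, ?_, ?_⟩
      · have := hs.length_le
        rw [List.length_append]
        nlinarith
      · rwa [Finset.card_image_of_injective _ (List.append_right_injective _)]
      · intro y hy
        obtain ⟨t, ht, rfl⟩ := Finset.mem_image.1 hy
        obtain ⟨h₁, v', hv', hsv⟩ := hS' t ht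
        exact ⟨by simp [h₁, Function.comp_def], _, ⟨_, hx₀, _, hv', rfl⟩,
          List.infix_append_iff.2 (.inr (.inr ⟨_, _, rfl, hs.map _, hsv⟩))⟩

end Marking

end RS

namespace RS

section Entropy

variable {A B : Type*} {θ : A → Set (List A)} {e : B ≃ A × Bool} {N : ℕ}

lemma map_fst_mem_X {x : ℤ → B} (hx : x ∈ X (marked e (powSubst θ N))) :
    (fun i => (e (x i)).1) ∈ X θ := by
  intro i n
  rw [← map_subwordAt (fun c => (e c).1)]
  exact legal_of_legal_powSubst (hx i n).map_fst

lemma map_symm_false_mem_X (h : IsRandomSubst θ) (hp : Primitive θ) (hN : 1 ≤ N)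
    {x : ℤ → A} (hx : x ∈ X θ) :
    (fun i => e.symm (x i, false)) ∈ X (marked e (powSubst θ N)) := by
  intro i n
  rw [← map_subwordAt (fun a => e.symm (a, false))]
  apply Legal.map_symm_false
  obtain ⟨j, a, w, hw, v, hv, huv⟩ := (hx i n).exists_powSubst h hp hN
  exact ⟨j + 1, a, v, mem_realPow_succ'.2 ⟨w, hw, hv⟩, huv⟩

lemma exists_isFactorMap [TopologicalSpace A] [TopologicalSpace B] [DiscreteTopology B]
    (h : IsRandomSubst θ) (hp : Primitive θ) (hN : 1 ≤ N) :
    ∃ f : X (marked e (powSubst θ N)) → X θ,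
      IsFactorMap (X (marked e (powSubst θ N))) (X θ) f := by
  refine ⟨fun x => ⟨fun i => (e (x.1 i)).1, map_fst_mem_X x.2⟩, ?_, ?_, fun x hx hx' => rfl⟩
  · refine Continuous.subtype_mk (continuous_pi fun i => ?_) _
    exact (continuous_of_discreteTopology (f := fun c : B => (e c).1)).comp
      ((continuous_apply i).comp continuous_subtype_val)
  · rintro ⟨x, hx⟩
    exact ⟨⟨_, map_symm_false_mem_X h hp hN hx⟩, by simp⟩

lemma map_fst_mem_lang {n : ℕ} {u : List B}
    (hu : u ∈ lang (X (marked e (powSubst θ N))) n) :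
    u.map (fun c => (e c).1) ∈ lang (X θ) n := by
  obtain ⟨hlen, x, hx, i, rfl⟩ := hu
  refine ⟨by simpa using hlen, _, map_fst_mem_X hx, i, ?_⟩
  rw [map_subwordAt]

lemma two_pow_mul_ncard_lang_le [Finite A] (h : IsRandomSubst θ) (hp : Primitive θ)
    (hN : 1 ≤ N) {M : ℕ} (hM : ∀ a, ∀ v ∈ powSubst θ N a, v.length ≤ M)
    (hext : ∀ u, Legal (marked e (powSubst θ N)) u →
      ∃ c d, Legal (marked e (powSubst θ N)) (c :: (u ++ [d]))) (n : ℕ) :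
    2 ^ (n / M - 2) * (lang (X θ) n).ncard ≤ (lang (X (marked e (powSubst θ N))) n).ncard := by
  classical
  have : Finite B := Finite.of_equiv _ e.symm
  rw [Set.ncard_eq_toFinset_card _ (lang_finite _ n),
    Set.ncard_eq_toFinset_card _ (lang_finite _ n),
    Finset.card_eq_sum_card_fiberwise (f := fun u : List B => u.map fun c => (e c).1)
      (t := (lang_finite (X θ) n).toFinset)
      (fun u hu => by simpa using map_fst_mem_lang (by simpa using hu)),
    mul_comm, ← smul_eq_mul]
  refine Finset.card_nsmul_le_sum _ _ _ fun u hu => ?_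
  obtain ⟨hlen, x, hx, i, rfl⟩ : u ∈ lang (X θ) n := by simpa using hu
  obtain ⟨j, a, w, hw, v, hv, huv⟩ := (hx i n).exists_powSubst h hp hN
  obtain ⟨k, S, hk, hS, hS'⟩ :=
    exists_lifts_of_infix (e := e) (isRandomSubst_powSubst h N) hM hv huv
  rw [hlen] at hk
  have hk' : n / M - 2 ≤ k := by
    have := Nat.div_le_of_le_mul hk
    omega
  refine (Nat.pow_le_pow_right two_pos hk').trans (hS.trans (Finset.card_le_card ?_))
  intro u' hu'
  obtain ⟨hmap, v', hv', huv'⟩ := hS' u' hu'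
  rw [Finset.mem_filter]
  refine ⟨?_, hmap⟩
  have hlen' : u'.length = n := by rw [← hlen, ← hmap, List.length_map]
  have hlegal : Legal (marked e (powSubst θ N)) u' := by
    obtain ⟨k', b, z, hz, hwz⟩ := Legal.map_symm_false (e := e)
      (⟨j, a, w, hw, List.infix_refl _⟩ : Legal (powSubst θ N) w)
    obtain ⟨s, t, rfl⟩ := hwz
    obtain ⟨v₁, -, v₂, -, hmem⟩ := exists_extend_realPow (k := 1)
      (isRandomSubst_marked (e := e) (isRandomSubst_powSubst h N)) s t
      (by rwa [realPow_one])
    rw [realPow_one] at hmem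
    exact ⟨k' + 1, b, _, mem_realPow_succ'.2 ⟨_, hz, by simpa using hmem⟩,
      huv'.trans (List.infix_append' _ _ _)⟩
  obtain ⟨y, hy, hyu⟩ := exists_mem_X_of_legal hext hlegal
  rw [Set.Finite.mem_toFinset]
  exact ⟨hlen', y, hy, 0, hlen' ▸ hyu⟩

lemma pow_mul_ncard_countP_le {t : ℝ} (ht₀ : 0 < t) (ht₁ : t ≤ 1) (n m : ℕ) :
    t ^ m * ({l : List Bool | l.length = n ∧ l.countP id ≤ m}.ncard : ℝ) ≤ (1 + t) ^ n := by
  have hfin : ∀ n m : ℕ, {l : List Bool | l.length = n ∧ l.countP id ≤ m}.Finite :=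
    fun n m => (List.finite_length_eq Bool n).subset fun l hl => hl.1
  induction n generalizing m with
  | zero =>
    have hle : {l : List Bool | l.length = 0 ∧ l.countP id ≤ m}.ncard ≤ 1 := by
      rw [← Set.ncard_singleton ([] : List Bool)]
      exact Set.ncard_le_ncard (fun l hl => List.length_eq_zero_iff.1 hl.1)
    have hle' : ({l : List Bool | l.length = 0 ∧ l.countP id ≤ m}.ncard : ℝ) ≤ 1 := by
      exact_mod_cast hle
    simpa using mul_le_one₀ (pow_le_one₀ ht₀.le ht₁) (Nat.cast_nonneg _) hle'
  | succ n ih =>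
    cases m with
    | zero =>
      have hsub : {l : List Bool | l.length = n + 1 ∧ l.countP id ≤ 0} ⊆
          List.cons false '' {l : List Bool | l.length = n ∧ l.countP id ≤ 0} := by
        rintro (_ | ⟨_ | _, l⟩) ⟨h₁, h₂⟩
        · simp at h₁
        · exact ⟨l, ⟨by simpa using h₁, by simpa using h₂⟩, rfl⟩
        · simp at h₂
      have hle := (Set.ncard_le_ncard hsub ((hfin _ _).image _)).trans
        (Set.ncard_image_le (hfin _ _))
      calc t ^ 0 * ({l : List Bool | l.length = n + 1 ∧ l.countP id ≤ 0}.ncard : ℝ)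
          ≤ t ^ 0 * ({l : List Bool | l.length = n ∧ l.countP id ≤ 0}.ncard : ℝ) := by
            gcongr
        _ ≤ (1 + t) ^ n := ih 0
        _ ≤ (1 + t) ^ (n + 1) := pow_le_pow_right₀ (by linarith) (Nat.le_succ n)
    | succ m =>
      have hsub : {l : List Bool | l.length = n + 1 ∧ l.countP id ≤ m + 1} ⊆
          List.cons false '' {l : List Bool | l.length = n ∧ l.countP id ≤ m + 1} ∪
          List.cons true '' {l : List Bool | l.length = n ∧ l.countP id ≤ m} := by
        rintro (_ | ⟨_ | _, l⟩) ⟨h₁, h₂⟩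
        · simp at h₁
        · exact .inl ⟨l, ⟨by simpa using h₁, by simpa using h₂⟩, rfl⟩
        · exact .inr ⟨l, ⟨by simpa using h₁, by simpa using h₂⟩, rfl⟩
      have hle := (Set.ncard_le_ncard hsub (((hfin _ _).image _).union ((hfin _ _).image _))).trans
        ((Set.ncard_union_le _ _).trans
          (add_le_add (Set.ncard_image_le (hfin _ _)) (Set.ncard_image_le (hfin _ _))))
      calc t ^ (m + 1) * ({l : List Bool | l.length = n + 1 ∧ l.countP id ≤ m + 1}.ncard : ℝ)
          ≤ t ^ (m + 1) * ({l : List Bool | l.length = n ∧ l.countP id ≤ m + 1}.ncard +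
              {l : List Bool | l.length = n ∧ l.countP id ≤ m}.ncard : ℝ) := by
            gcongr
            exact_mod_cast hle
        _ = t ^ (m + 1) * ({l : List Bool | l.length = n ∧ l.countP id ≤ m + 1}.ncard : ℝ) +
            t * (t ^ m * ({l : List Bool | l.length = n ∧ l.countP id ≤ m}.ncard : ℝ)) := by
            ring
        _ ≤ (1 + t) ^ n + t * (1 + t) ^ n := by
            gcongr
            · exact ih (m + 1)
            · exact ih m
        _ = (1 + t) ^ (n + 1) := by ring

lemma pow_mul_ncard_lang_le [Finite A] {t : ℝ} (ht₀ : 0 < t) (ht₁ : t ≤ 1) {L : ℕ}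
    (hL₀ : 0 < L) (hL : ∀ a, ∀ v ∈ powSubst θ N a, L ≤ v.length) (n : ℕ) :
    t ^ (n / L + 2) * ((lang (X (marked e (powSubst θ N))) n).ncard : ℝ) ≤
      (lang (X θ) n).ncard * (1 + t) ^ n := by
  have hmaps : ∀ u ∈ lang (X (marked e (powSubst θ N))) n,
      (u.map (fun c => (e c).1), u.map fun c => (e c).2) ∈
        lang (X θ) n ×ˢ {l : List Bool | l.length = n ∧ l.countP id ≤ n / L + 2} := by
    intro u hu
    refine ⟨map_fst_mem_lang hu, by simpa using hu.1, ?_⟩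
    obtain ⟨hlen, x, hx, i, rfl⟩ := hu
    have := (hx i n).countP_le hL
    rw [hlen] at this
    rw [List.countP_map, ← Nat.add_mul_div_right n 2 hL₀, Nat.le_div_iff_mul_le hL₀, mul_comm]
    exact this
  have hinj : Set.InjOn (fun u : List B => (u.map (fun c => (e c).1), u.map fun c => (e c).2))
      (lang (X (marked e (powSubst θ N))) n) := by
    intro u _ v _ huv
    obtain ⟨h₁, h₂⟩ := Prod.mk.inj huv
    have hlen : u.length = v.length := by simpa using congrArg List.length h₁
    refine List.ext_getElem hlen fun i hi hi' => e.injective (Prod.ext ?_ ?_)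
    · simpa [hi, hi'] using congrArg (fun l => l[i]?) h₁
    · simpa [hi, hi'] using congrArg (fun l => l[i]?) h₂
  have hfin : {l : List Bool | l.length = n ∧ l.countP id ≤ n / L + 2}.Finite :=
    (List.finite_length_eq Bool n).subset fun l hl => hl.1
  have hle := Set.ncard_le_ncard_of_injOn _ hmaps hinj ((lang_finite _ n).prod hfin)
  rw [Set.ncard_prod] at hle
  calc t ^ (n / L + 2) * ((lang (X (marked e (powSubst θ N))) n).ncard : ℝ)
      ≤ t ^ (n / L + 2) * ((lang (X θ) n).ncard *
        ({l : List Bool | l.length = n ∧ l.countP id ≤ n / L + 2}.ncard : ℝ)) := by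
        gcongr
        exact_mod_cast hle
    _ = (lang (X θ) n).ncard * (t ^ (n / L + 2) *
        ({l : List Bool | l.length = n ∧ l.countP id ≤ n / L + 2}.ncard : ℝ)) := by ring
    _ ≤ (lang (X θ) n).ncard * (1 + t) ^ n := by
        gcongr
        exact pow_mul_ncard_countP_le ht₀ ht₁ n _

lemma entropy_add_le_entropy {A' : Type*} [Fintype A] [Fintype A'] {Y : Set (ℤ → A)}
    {Z : Set (ℤ → A')} (hY : Y.Nonempty) (hZ : Z.Nonempty) {c : ℝ}
    (h : ∀ᶠ n : ℕ in Filter.atTop,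
      Real.log ((lang Y n).ncard) + c * n ≤ Real.log ((lang Z n).ncard)) :
    entropy Y + c ≤ entropy Z := by
  refine limsup_add_le_limsup
    (K := max (Real.log (Fintype.card A)) (Real.log (Fintype.card A')))
    (fun n => div_nonneg (Real.log_natCast_nonneg _) (Nat.cast_nonneg n))
    (fun n => (log_ncard_lang_div_le hY n).trans (le_max_left _ _))
    (fun n => (log_ncard_lang_div_le hZ n).trans (le_max_right _ _)) ?_
  filter_upwards [h, Filter.eventually_gt_atTop 0] with n hn hn₀
  have hn₀' : (0 : ℝ) < n := by exact_mod_cast hn₀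
  rw [le_div_iff₀ hn₀', add_mul, div_mul_cancel₀ _ hn₀'.ne']
  exact hn

lemma entropy_lt_entropy_marked [Fintype A] [Fintype B] (hne : (X θ).Nonempty)
    (h : IsRandomSubst θ) (hp : Primitive θ) (hN : 1 ≤ N)
    (hext : ∀ u, Legal (marked e (powSubst θ N)) u →
      ∃ c d, Legal (marked e (powSubst θ N)) (c :: (u ++ [d]))) :
    entropy (X θ) < entropy (X (marked e (powSubst θ N))) := by
  obtain ⟨M₀, hM₀⟩ := ((Set.finite_iUnion fun a =>
    (isRandomSubst_powSubst h N a).2.1).image List.length).bddAbove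
  obtain ⟨M, hM₁, hM⟩ : ∃ M : ℕ, 0 < M ∧ ∀ a, ∀ v ∈ powSubst θ N a, v.length ≤ M :=
    ⟨M₀ + 1, Nat.succ_pos _, fun a v hv =>
      (hM₀ ⟨v, Set.mem_iUnion.2 ⟨a, hv⟩, rfl⟩).trans (Nat.le_succ _)⟩
  have hM₁' : (0 : ℝ) < M := by exact_mod_cast hM₁
  have hlog : 0 < Real.log 2 := Real.log_pos one_lt_two
  have hZ : (X (marked e (powSubst θ N))).Nonempty :=
    hne.elim fun x hx => ⟨_, map_symm_false_mem_X h hp hN hx⟩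
  suffices hle : entropy (X θ) + Real.log 2 / (2 * M) ≤ entropy (X (marked e (powSubst θ N))) by
    have : 0 < Real.log 2 / (2 * M) := by positivity
    linarith
  refine entropy_add_le_entropy hne hZ ?_
  filter_upwards [Filter.eventually_ge_atTop (6 * M)] with n hn
  have hpos : (0 : ℝ) < (lang (X θ) n).ncard := by exact_mod_cast ncard_lang_pos hne n
  have hcard : (2 : ℝ) ^ (n / M - 2) * (lang (X θ) n).ncard ≤
      (lang (X (marked e (powSubst θ N))) n).ncard := by
    exact_mod_cast two_pow_mul_ncard_lang_le h hp hN hM hext n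
  have hl := Real.log_le_log (by positivity) hcard
  rw [Real.log_mul (by positivity) hpos.ne', Real.log_pow] at hl
  have hk : (n : ℝ) / M - 3 ≤ ((n / M - 2 : ℕ) : ℝ) := by
    have h₁ : n < M * (n / M - 2 + 3) := by
      have := Nat.lt_mul_div_succ n hM₁
      exact this.trans_le (Nat.mul_le_mul_left M (by omega))
    have h₂ : (n : ℝ) < M * (((n / M - 2 : ℕ) : ℝ) + 3) := by exact_mod_cast h₁
    rw [sub_le_iff_le_add, div_le_iff₀ hM₁']
    linarith
  have hn' : 6 ≤ (n : ℝ) / M := by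
    rw [le_div_iff₀ hM₁']
    exact_mod_cast hn
  have hc : Real.log 2 / (2 * M) * n = (n : ℝ) / M / 2 * Real.log 2 := by
    field_simp
  rw [hc]
  nlinarith

lemma entropy_marked_le [Fintype A] [Fintype B] (hne : (X θ).Nonempty)
    (h : IsRandomSubst θ) (hp : Primitive θ) (hN : 1 ≤ N) {t : ℝ} (ht₀ : 0 < t) (ht₁ : t ≤ 1)
    {L : ℕ} (hL₀ : 0 < L) (hL : ∀ a, ∀ v ∈ powSubst θ N a, L ≤ v.length) {δ : ℝ} (hδ : 0 < δ) :
    entropy (X (marked e (powSubst θ N))) ≤ entropy (X θ) + (t - Real.log t / L + δ) := by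
  have hZ : (X (marked e (powSubst θ N))).Nonempty :=
    hne.elim fun x hx => ⟨_, map_symm_false_mem_X h hp hN hx⟩
  rw [← sub_le_iff_le_add, sub_eq_add_neg]
  refine entropy_add_le_entropy hZ hne ?_
  have hlog : Real.log t ≤ 0 := Real.log_nonpos ht₀.le ht₁
  filter_upwards [Filter.eventually_ge_atTop ⌈-(2 * Real.log t) / δ⌉₊] with n hn
  have hn' : -(2 * Real.log t) ≤ δ * n := by
    have := Nat.ceil_le.1 hn
    rwa [div_le_iff₀ hδ, mul_comm (n : ℝ)] at this
  have hpos : (0 : ℝ) < (lang (X θ) n).ncard := by exact_mod_cast ncard_lang_pos hne n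
  have hpos' : (0 : ℝ) < (lang (X (marked e (powSubst θ N))) n).ncard := by
    exact_mod_cast ncard_lang_pos hZ n
  have hl := Real.log_le_log (by positivity)
    (pow_mul_ncard_lang_le (e := e) ht₀ ht₁ hL₀ hL n)
  rw [Real.log_mul (by positivity) hpos'.ne', Real.log_mul hpos.ne' (by positivity),
    Real.log_pow, Real.log_pow] at hl
  have ht : Real.log (1 + t) ≤ t := by
    have := Real.log_le_sub_one_of_pos (show 0 < 1 + t by linarith)
    linarith
  have hnt : n * Real.log (1 + t) ≤ n * t := by gcongr
  have hdiv : ((n / L : ℕ) : ℝ) ≤ (n : ℝ) / L := Nat.cast_div_le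
  have hmul := mul_le_mul_of_nonpos_right hdiv hlog
  have hc : Real.log t / L * n = (n : ℝ) / L * Real.log t := by ring
  push_cast at hl
  nlinarith

end Entropy

end RS

/-- For every `ε > 0` and every non-deterministic primitive random substitution
`θ` of minimum exponential growth with nonempty RS-subshift, there is a primitive random
substitution whose RS-subshift factors onto `X θ` and whose entropy lies strictly between
`h θ` and `h θ + ε`. -/
theorem stmt16 {A : Type*} [Fintype A] [TopologicalSpace A] [DiscreteTopology A]
    (ε : ℝ) (hε : 0 < ε)
    (θ : A → Set (List A)) (hrs : RS.IsRandomSubst θ) (hprim : RS.Primitive θ)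
    (hne : (RS.X θ).Nonempty)
    (hnondet : ∃ a : A, ∃ u ∈ θ a, ∃ v ∈ θ a, u ≠ v)
    (hming : ∃ r : ℝ, 1 < r ∧ ∃ C : ℝ, 0 < C ∧
      ∀ (n : ℕ) (a : A), ∀ w ∈ RS.realPow θ n [a], C * r ^ n ≤ (w.length : ℝ)) :
    ∃ (n : ℕ) (θ' : Fin n → Set (List (Fin n))),
      RS.IsRandomSubst θ' ∧ RS.Primitive θ' ∧
      (∃ f : (RS.X θ') → (RS.X θ), RS.IsFactorMap (RS.X θ') (RS.X θ) f) ∧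
      RS.entropy (RS.X θ) < RS.entropy (RS.X θ') ∧
      RS.entropy (RS.X θ') < RS.entropy (RS.X θ) + ε := by
  obtain ⟨r, hr, C, hC, hgrow⟩ := hming
  obtain ⟨t, ht₀, ht₁, htε⟩ : ∃ t : ℝ, 0 < t ∧ t ≤ 1 ∧ t ≤ ε / 4 :=
    ⟨min 1 (ε / 4), by positivity, min_le_left _ _, min_le_right _ _⟩
  obtain ⟨L, hL⟩ := exists_nat_ge (max 3 (-Real.log t / (ε / 4)))
  have hL₃ : 3 ≤ L := by exact_mod_cast (le_max_left _ _).trans hL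
  have hLt : -(Real.log t / L) ≤ ε / 4 := by
    have hL₀ : (0 : ℝ) < L := by exact_mod_cast (by omega : 0 < L)
    have := (le_max_right _ _).trans hL
    rw [div_le_iff₀ (by positivity)] at this
    rw [← neg_div, div_le_iff₀ hL₀]
    linarith
  obtain ⟨N₀, hN₀⟩ := pow_unbounded_of_one_lt ((L : ℝ) / C) hr
  obtain ⟨N, hN₁, hN⟩ : ∃ N, 1 ≤ N ∧ ∀ a, ∀ v ∈ RS.powSubst θ N a, L ≤ v.length := by
    refine ⟨N₀ + 1, Nat.le_add_left _ _, fun a v hv => ?_⟩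
    have h₁ := hgrow _ a v hv
    have h₂ : r ^ N₀ ≤ r ^ (N₀ + 1) := pow_le_pow_right₀ hr.le (Nat.le_succ _)
    rw [div_lt_iff₀ hC] at hN₀
    have h₃ : (L : ℝ) ≤ v.length := by nlinarith
    exact_mod_cast h₃
  let e : Fin (Fintype.card (A × Bool)) ≃ A × Bool := (Fintype.equivFin _).symm
  have hφ := RS.isRandomSubst_powSubst hrs N
  have hmarked : RS.IsRandomSubst (RS.marked e (RS.powSubst θ N)) := RS.isRandomSubst_marked hφ
  have hmarked' : RS.Primitive (RS.marked e (RS.powSubst θ N)) :=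
    RS.primitive_marked hφ (RS.primitive_powSubst hrs hprim hN₁)
  refine ⟨_, RS.marked e (RS.powSubst θ N), hmarked, hmarked',
    RS.exists_isFactorMap hrs hprim hN₁, ?_, ?_⟩
  · refine RS.entropy_lt_entropy_marked hne hrs hprim hN₁ fun u hu =>
      hu.exists_extend hmarked hmarked' fun b => ?_
    obtain ⟨v, hv⟩ := (hmarked b).1
    exact ⟨v, hv, by simpa using hL₃.trans (hN _ _ hv.1)⟩
  · have := RS.entropy_marked_le (e := e) hne hrs hprim hN₁ ht₀ ht₁ (by omega) hN
      (δ := ε / 4) (by positivity)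
    linarith
end

section
/- The set H = {h_top(X_θ) : θ a primitive random substitution on some finite alphabet with nonempty RS-subshift X_θ} is a dense subset of the nonnegative real numbers [0,∞). -/
/-- The set of values of topological entropy attained by primitive random substitutions on
finite alphabets (realised as the alphabets `Fin n`) with nonempty RS-subshift. -/
def entropySet : Set ℝ :=
  {h : ℝ | ∃ (n : ℕ) (θ : Fin n → Set (List (Fin n))),
    RS.IsRandomSubst θ ∧ RS.Primitive θ ∧ (RS.X θ).Nonempty ∧ RS.entropy (RS.X θ) = h}

namespace RS

/-- The concatenation of the words `i 0 ⋯ 0` of length `L`, with `i` running through `c`. -/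
def blocks (p L : ℕ) (c : List (Fin (p + 1))) : List (Fin (p + 1)) :=
  c.flatMap fun i => i :: List.replicate (L - 1) 0

/-- The random substitution sending every letter to all the words `i 0 ⋯ 0` of length `L`. -/
def blockSubst (p L : ℕ) (_ : Fin (p + 1)) : Set (List (Fin (p + 1))) :=
  Set.range fun i => i :: List.replicate (L - 1) 0

variable {p L : ℕ}

lemma length_blocks (hL : 2 ≤ L) (c : List (Fin (p + 1))) :
    (blocks p L c).length = c.length * L := by
  induction c with
  | nil => simp [blocks]
  | cons a c ih =>
    have : blocks p L (a :: c) = (a :: List.replicate (L - 1) 0) ++ blocks p L c := rfl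
    rw [this, List.length_append, ih]
    simp only [List.length_cons, List.length_replicate]
    rw [Nat.add_mul]
    omega

lemma getD_blocks (hL : 2 ≤ L) (c : List (Fin (p + 1))) (j : ℕ) :
    (blocks p L c).getD j 0 = if j % L = 0 then c.getD (j / L) 0 else 0 := by
  induction c generalizing j with
  | nil => simp [blocks]
  | cons a c ih =>
    have h : blocks p L (a :: c) = (a :: List.replicate (L - 1) 0) ++ blocks p L c := rfl
    have hlen : (a :: List.replicate (L - 1) (0 : Fin (p + 1))).length = L := by
      simp only [List.length_cons, List.length_replicate]
      omega
    rw [h]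
    rcases lt_or_ge j L with hj | hj
    · rw [List.getD_append _ _ _ _ (by omega), Nat.mod_eq_of_lt hj, Nat.div_eq_of_lt hj]
      rcases j with _ | j
      · simp
      · rw [List.getD_cons_succ, if_neg (by omega), List.getD_replicate _ (by omega)]
    · rw [List.getD_append_right _ _ _ _ (by omega), hlen, ih]
      obtain ⟨k, rfl⟩ := Nat.exists_eq_add_of_le hj
      rw [Nat.add_sub_cancel_left, Nat.add_mod_left, Nat.add_div_left _ (by omega),
        List.getD_cons_succ]

lemma mem_real_blockSubst (w u : List (Fin (p + 1))) :
    u ∈ real (blockSubst p L) w ↔ ∃ c, c.length = w.length ∧ u = blocks p L c := by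
  induction w generalizing u with
  | nil => simp [real, blocks]
  | cons a w ih =>
    constructor
    · rintro ⟨v, ⟨i, rfl⟩, r, hr, rfl⟩
      obtain ⟨c, hc, rfl⟩ := (ih r).1 hr
      exact ⟨i :: c, by simp [hc], rfl⟩
    · rintro ⟨c, hc, rfl⟩
      rcases c with _ | ⟨i, c⟩
      · simp at hc
      · exact ⟨_, ⟨i, rfl⟩, blocks p L c, (ih _).2 ⟨c, by simpa using hc, rfl⟩, rfl⟩

lemma mem_realPow_blockSubst (hL : 2 ≤ L) (k : ℕ) (w u : List (Fin (p + 1))) :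
    u ∈ realPow (blockSubst p L) (k + 1) w ↔
      ∃ c, c.length = w.length * L ^ k ∧ u = blocks p L c := by
  induction k generalizing w with
  | zero =>
    have : realPow (blockSubst p L) 1 w = real (blockSubst p L) w := by
      simp [realPow]
    simp [this, mem_real_blockSubst]
  | succ k ih =>
    have : realPow (blockSubst p L) (k + 1 + 1) w =
      ⋃ v ∈ real (blockSubst p L) w, realPow (blockSubst p L) (k + 1) v := rfl
    simp only [this, Set.mem_iUnion, ih, mem_real_blockSubst, exists_prop]
    constructor
    · rintro ⟨v, ⟨c, hc, rfl⟩, d, hd, rfl⟩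
      exact ⟨d, by rw [hd, length_blocks hL, hc]; ring, rfl⟩
    · rintro ⟨d, hd, rfl⟩
      exact ⟨_, ⟨w, rfl, rfl⟩, d, by rw [hd, length_blocks hL]; ring, rfl⟩

lemma isRandomSubst_blockSubst : IsRandomSubst (blockSubst p L) := by
  refine fun a => ⟨Set.range_nonempty _, Set.finite_range _, ?_⟩
  rintro u ⟨i, rfl⟩
  simp

lemma primitive_blockSubst (hL : 2 ≤ L) : Primitive (blockSubst p L) := by
  refine ⟨1, fun a b => ⟨blocks p L [a], ?_, by simp [blocks]⟩⟩
  rw [mem_realPow_blockSubst hL 0]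
  exact ⟨[a], by simp, rfl⟩

lemma exists_residue_of_legal (hL : 2 ≤ L) {u : List (Fin (p + 1))}
    (hu : Legal (blockSubst p L) u) : ∃ r < L, ∀ j, j % L ≠ r → u.getD j 0 = 0 := by
  obtain ⟨k, a, v, hv, s, t, rfl⟩ := hu
  rcases k with _ | k
  · have hlen : (s ++ u ++ t).length = 1 := by
      rw [show s ++ u ++ t = [a] from hv]
      rfl
    simp only [List.length_append] at hlen
    refine ⟨0, by omega, fun j hj => List.getD_eq_default _ _ ?_⟩
    have : j ≠ 0 := by
      rintro rfl
      simp at hj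
    omega
  · obtain ⟨c, -, hc⟩ := (mem_realPow_blockSubst hL k _ _).1 hv
    refine ⟨(L - s.length % L) % L, Nat.mod_lt _ (by omega), fun j hj => ?_⟩
    rcases le_or_gt u.length j with hju | hju
    · exact List.getD_eq_default _ _ hju
    · have h := getD_blocks hL c (s.length + j)
      rw [← hc, List.getD_append _ _ _ _ (by simp; omega),
        List.getD_append_right _ _ _ _ (by omega), Nat.add_sub_cancel_left, if_neg] at h
      · exact h
      · intro h0
        apply hj
        have hs := Nat.mod_lt s.length (show 0 < L by omega)
        have hjl := Nat.mod_lt j (show 0 < L by omega)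
        rw [Nat.add_mod] at h0
        rcases Nat.eq_zero_or_pos (s.length % L) with h1 | h1
        · rw [h1, Nat.zero_add, Nat.mod_mod] at h0
          simp [h1, h0]
        · rw [Nat.mod_eq_of_lt (show L - s.length % L < L by omega)]
          rcases lt_or_ge (s.length % L + j % L) L with h2 | h2
          · rw [Nat.mod_eq_of_lt h2] at h0
            omega
          · rw [Nat.mod_eq_sub_mod h2, Nat.mod_eq_of_lt (by omega)] at h0
            omega

/-- The bi-infinite sequence carrying `g` on the multiples of `L` and `0` elsewhere. -/
def spread (L : ℕ) (g : ℤ → Fin (p + 1)) (i : ℤ) : Fin (p + 1) :=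
  if i % L = 0 then g (i / L) else 0

lemma subwordAt_infix {A : Type*} (x : ℤ → A) (i : ℤ) (a b c : ℕ) :
    subwordAt x (i + a) b <:+: subwordAt x i (a + b + c) := by
  refine ⟨subwordAt x i a, subwordAt x (i + (a + b : ℕ)) c, ?_⟩
  simp only [subwordAt, List.ofFn_add]
  simp [add_assoc]

lemma subwordAt_spread (hL : 2 ≤ L) (g : ℤ → Fin (p + 1)) (s : ℤ) (t : ℕ) :
    subwordAt (spread L g) (L * s) (t * L) = blocks p L (subwordAt g s t) := by
  refine List.ext_getElem (by simp [length_blocks hL, subwordAt]) fun j h₁ h₂ => ?_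
  have hj : j < t * L := by simpa [subwordAt] using h₁
  have hjt : j / L < t := Nat.div_lt_of_lt_mul (by rwa [mul_comm])
  have hL0 : (L : ℤ) ≠ 0 := by omega
  rw [← List.getD_eq_getElem _ 0 h₂, getD_blocks hL,
    List.getD_eq_getElem _ _ (by simpa [subwordAt] using hjt)]
  simp only [subwordAt, List.getElem_ofFn, spread]
  rw [add_comm (L * s : ℤ), Int.add_mul_emod_self_left, Int.add_mul_ediv_left _ _ hL0, add_comm s]
  norm_cast

lemma spread_mem_X (hL : 2 ≤ L) (g : ℤ → Fin (p + 1)) :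
    spread L g ∈ X (blockSubst p L) := by
  intro i n
  have hL0 : (0 : ℤ) < L := by omega
  refine ⟨n + 1, 0, subwordAt (spread L g) (L * (i / L)) (L ^ n * L), ?_, ?_⟩
  · rw [mem_realPow_blockSubst hL, subwordAt_spread hL]
    exact ⟨_, by simp [subwordAt], rfl⟩
  · obtain ⟨a, ha⟩ := Int.eq_ofNat_of_zero_le (Int.emod_nonneg i hL0.ne')
    have haL : a < L := by
      have := Int.emod_lt_of_pos i hL0
      omega
    have hi : i = L * (i / L) + a := by
      rw [← ha]
      exact (Int.mul_ediv_add_emod i L).symm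
    have hn : n + 1 ≤ L ^ n := Nat.lt_pow_self (by omega)
    have hle : a + n ≤ L ^ n * L := by nlinarith
    obtain ⟨c, hc⟩ := Nat.exists_eq_add_of_le hle
    rw [hc]
    conv_lhs => rw [hi]
    exact subwordAt_infix _ _ _ _ _

lemma lang_subset_range (hL : 2 ≤ L) (n : ℕ) :
    lang (X (blockSubst p L)) n ⊆ Set.range fun q : Fin L × (Fin (n / L + 1) → Fin (p + 1)) =>
      List.ofFn fun j : Fin n => if (j : ℕ) % L = q.1 then
        q.2 ⟨j / L, Nat.lt_succ_of_le (Nat.div_le_div_right j.2.le)⟩ else 0 := by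
  rintro u ⟨hn, x, hx, i, rfl⟩
  obtain ⟨r, hr, h⟩ := exists_residue_of_legal hL (hx i n)
  refine ⟨⟨⟨r, hr⟩, fun q => (subwordAt x i n).getD (L * q + r) 0⟩, ?_⟩
  refine List.ext_getElem (by simp [subwordAt]) fun j h₁ h₂ => ?_
  rw [← List.getD_eq_getElem _ 0 h₂]
  simp only [List.getElem_ofFn]
  split_ifs with hj
  · rw [← hj, Nat.div_add_mod]
  · exact (h j hj).symm

lemma finite_lang (hL : 2 ≤ L) (n : ℕ) : (lang (X (blockSubst p L)) n).Finite :=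
  (Set.finite_range _).subset (lang_subset_range hL n)

lemma ncard_lang_le_s18 (hL : 2 ≤ L) (n : ℕ) :
    (lang (X (blockSubst p L)) n).ncard ≤ L * (p + 1) ^ (n / L + 1) := by
  refine (Set.ncard_le_ncard (lang_subset_range hL n) (Set.finite_range _)).trans ?_
  rw [← Set.image_univ]
  refine (Set.ncard_image_le Set.finite_univ).trans ?_
  simp [Set.ncard_univ]

lemma le_ncard_lang (hL : 2 ≤ L) (n : ℕ) :
    (p + 1) ^ (n / L) ≤ (lang (X (blockSubst p L)) n).ncard := by
  let e : (Fin (n / L) → Fin (p + 1)) → List (Fin (p + 1)) := fun f =>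
    subwordAt (spread L fun i => (List.ofFn f).getD i.toNat 0) 0 n
  have he : Function.Injective e := by
    intro f f' h
    funext q
    have hL0 : (L : ℤ) ≠ 0 := by omega
    have hq : L * (q : ℕ) < n := by
      have h₁ := Nat.mul_le_mul_left L (Nat.succ_le_of_lt q.2)
      have h₂ := Nat.mul_div_le n L
      rw [Nat.mul_succ] at h₁
      omega
    have h' := congrFun (List.ofFn_injective h) ⟨L * q, hq⟩
    simpa [spread, Int.mul_ediv_cancel_left _ hL0] using h'
  calc (p + 1) ^ (n / L) = (Set.range e).ncard := by
        rw [← Set.image_univ, Set.ncard_image_of_injective _ he]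
        simp [Set.ncard_univ]
    _ ≤ _ := by
        refine Set.ncard_le_ncard ?_ (finite_lang hL n)
        rintro _ ⟨f, rfl⟩
        exact ⟨by simp [e, subwordAt], _, spread_mem_X hL _, 0, rfl⟩

lemma entropy_blockSubst (hL : 2 ≤ L) :
    entropy (X (blockSubst p L)) = Real.log (p + 1) / L := by
  have hlog : 0 ≤ Real.log ((p : ℝ) + 1) := Real.log_nonneg (by simp)
  have hL0 : (0 : ℝ) < L := by positivity
  have hinv := tendsto_one_div_atTop_nhds_zero_nat (𝕜 := ℝ)
  refine Filter.Tendsto.limsup_eq (tendsto_of_tendsto_of_tendsto_of_le_of_le'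
    (g := fun n : ℕ => Real.log (p + 1) / L - Real.log (p + 1) * (1 / (n : ℝ)))
    (h := fun n : ℕ => Real.log (p + 1) / L + (Real.log L + Real.log (p + 1)) * (1 / (n : ℝ)))
    (by simpa using (hinv.const_mul (Real.log (p + 1))).const_sub (Real.log (p + 1) / L))
    (by simpa using (hinv.const_mul (Real.log L + Real.log (p + 1))).const_add (Real.log (p + 1) / L))
    ?_ ?_)
  · filter_upwards [Filter.eventually_gt_atTop 0] with n hn
    have hn0 : (0 : ℝ) < n := by exact_mod_cast hn
    have h₁ : Real.log (((p + 1) ^ (n / L) : ℕ) : ℝ) ≤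
        Real.log ((lang (X (blockSubst p L)) n).ncard) :=
      Real.log_le_log (by positivity) (by exact_mod_cast le_ncard_lang hL n)
    push_cast at h₁
    rw [Real.log_pow] at h₁
    have h₂ : (n : ℝ) / L - 1 ≤ ((n / L : ℕ) : ℝ) := by
      rw [← Nat.floor_div_eq_div (K := ℝ)]
      exact (Nat.sub_one_lt_floor _).le
    rw [le_div_iff₀ hn0]
    calc _ = ((n : ℝ) / L - 1) * Real.log (p + 1) := by field_simp
      _ ≤ _ := (mul_le_mul_of_nonneg_right h₂ hlog).trans h₁
  · filter_upwards [Filter.eventually_gt_atTop 0] with n hn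
    have hn0 : (0 : ℝ) < n := by exact_mod_cast hn
    have hpos : 0 < (lang (X (blockSubst p L)) n).ncard :=
      lt_of_lt_of_le (by positivity) (le_ncard_lang hL n)
    have h₁ : Real.log ((lang (X (blockSubst p L)) n).ncard) ≤
        Real.log ((L * (p + 1) ^ (n / L + 1) : ℕ) : ℝ) :=
      Real.log_le_log (by exact_mod_cast hpos) (by exact_mod_cast ncard_lang_le_s18 hL n)
    push_cast at h₁
    rw [Real.log_mul (by positivity) (by positivity), Real.log_pow] at h₁
    push_cast at h₁
    have h₂ : ((n / L : ℕ) : ℝ) ≤ (n : ℝ) / L := Nat.cast_div_le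
    rw [div_le_iff₀ hn0]
    calc _ ≤ _ := h₁
      _ ≤ Real.log L + ((n : ℝ) / L + 1) * Real.log (p + 1) := by gcongr
      _ = _ := by field_simp; ring

lemma entropy_nonneg {A : Type*} (Y : Set (ℤ → A)) : 0 ≤ entropy Y := by
  refine Real.sInf_nonneg fun a ha => ?_
  obtain ⟨n, hn⟩ := (Filter.eventually_map.1 ha).exists
  exact le_trans (by positivity) hn

end RS

lemma log_div_mem_entropySet (p : ℕ) {L : ℕ} (hL : 2 ≤ L) :
    Real.log (p + 1) / L ∈ entropySet :=
  ⟨p + 1, RS.blockSubst p L, RS.isRandomSubst_blockSubst, RS.primitive_blockSubst hL,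
    ⟨_, RS.spread_mem_X hL fun _ => 0⟩, RS.entropy_blockSubst hL⟩

/-- The set of entropies of primitive RS-subshifts is a dense subset of the
nonnegative real numbers. -/
theorem stmt18 : entropySet ⊆ Set.Ici (0 : ℝ) ∧ Set.Ici (0 : ℝ) ⊆ closure entropySet := by
  constructor
  · rintro h ⟨n, θ, -, -, -, rfl⟩
    exact RS.entropy_nonneg _
  · intro h hh
    rw [Set.mem_Ici] at hh
    have hinv := tendsto_one_div_atTop_nhds_zero_nat (𝕜 := ℝ)
    refine mem_closure_of_tendsto (b := Filter.atTop) (f := fun L : ℕ =>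
      Real.log ((⌊Real.exp (h * L)⌋₊ : ℝ) + 1) / L) ?_ ?_
    · refine tendsto_of_tendsto_of_tendsto_of_le_of_le'
        (h := fun L : ℕ => h + Real.log 2 * (1 / (L : ℝ))) tendsto_const_nhds
        (by simpa using (hinv.const_mul (Real.log 2)).const_add h) ?_ ?_
      · filter_upwards [Filter.eventually_gt_atTop 0] with L hL
        have hL0 : (0 : ℝ) < L := by exact_mod_cast hL
        rw [le_div_iff₀ hL0, Real.le_log_iff_exp_le (by positivity)]
        exact (Nat.lt_floor_add_one _).le
      · filter_upwards [Filter.eventually_gt_atTop 0] with L hL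
        have hL0 : (0 : ℝ) < L := by exact_mod_cast hL
        have h₁ : (1 : ℝ) ≤ Real.exp (h * L) := Real.one_le_exp (by positivity)
        have h₂ := Nat.floor_le (Real.exp_pos (h * L)).le
        rw [div_le_iff₀ hL0]
        calc _ ≤ Real.log (Real.exp (h * L) * 2) :=
              Real.log_le_log (by positivity) (by linarith)
          _ = h * L + Real.log 2 := by
              rw [Real.log_mul (Real.exp_pos _).ne' (by norm_num), Real.log_exp]
          _ = _ := by field_simp
    · filter_upwards [Filter.eventually_ge_atTop 2] with L hL
      exact log_div_mem_entropySet _ hL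
end

section
/- For every nonnegative rational number q there exists a primitive random substitution θ on some finite alphabet with nonempty RS-subshift X_θ whose topological entropy is h_θ = q · log 2. -/
namespace RS

open Filter Topology

section Phase

variable {A : Type*} {b : ℕ}

/-- The phases of the successive letters of the word are `p, p + 1, p + 2, …`. -/
def Phased (ph : A → ZMod b) : ZMod b → List A → Prop
  | _, [] => True
  | p, a :: w => ph a = p ∧ Phased ph (p + 1) w

/-- The random substitution sending a letter to all phased words of length `b + 1`
starting with the phase of that letter. -/
def phaseSubst (ph : A → ZMod b) (a : A) : Set (List A) :=
  {u | u.length = b + 1 ∧ Phased ph (ph a) u}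

/-- The phased words of length `n` with initial phase `p`. -/
def phasedWords (ph : A → ZMod b) (p : ZMod b) (n : ℕ) : Set (List A) :=
  {u | u.length = n ∧ Phased ph p u}

variable {ph : A → ZMod b}

theorem phased_append {p : ZMod b} {u v : List A} :
    Phased ph p (u ++ v) ↔ Phased ph p u ∧ Phased ph (p + u.length) v := by
  induction u generalizing p with
  | nil => simp [Phased]
  | cons a u ih =>
    simp only [List.cons_append, Phased, ih, List.length_cons, Nat.cast_add, Nat.cast_one,
      and_assoc, add_assoc, add_comm (1 : ZMod b)]

theorem phased_ofFn {p : ZMod b} {n : ℕ} {f : Fin n → A} :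
    Phased ph p (List.ofFn f) ↔ ∀ i, ph (f i) = p + (i : ℕ) := by
  induction n generalizing p with
  | zero => simp [Phased]
  | succ n ih =>
    simp only [List.ofFn_succ, Phased, ih, Fin.forall_fin_succ, Fin.val_zero, Nat.cast_zero,
      add_zero, Fin.val_succ, Nat.cast_add, Nat.cast_one, add_assoc, add_comm (1 : ZMod b)]

theorem Phased.getElem {p : ZMod b} {w : List A} (h : Phased ph p w) (i : ℕ)
    (hi : i < w.length) : ph w[i] = p + i := by
  rw [← List.ofFn_getElem (xs := w), phased_ofFn] at h
  exact h ⟨i, hi⟩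

theorem exists_phased (hs : Function.Surjective ph) (p : ZMod b) (n : ℕ) :
    ∃ w : List A, w.length = n ∧ Phased ph p w := by
  obtain ⟨s, hs⟩ := hs.hasRightInverse
  exact ⟨List.ofFn fun i : Fin n => s (p + (i : ℕ)), by simp,
    phased_ofFn.2 fun i => hs _⟩

theorem phased_of_mem_real {p : ZMod b} {w v : List A} (hw : Phased ph p w)
    (hv : v ∈ real (phaseSubst ph) w) : Phased ph p v := by
  induction w generalizing p v with
  | nil =>
    obtain rfl : v = [] := hv
    trivial
  | cons a w ih =>
    obtain ⟨u, ⟨hul, hu⟩, r, hr, rfl⟩ := hv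
    obtain ⟨rfl, hw⟩ := hw
    refine phased_append.2 ⟨hu, ?_⟩
    rw [hul]
    simpa using ih hw hr

theorem phased_of_mem_realPow {p : ZMod b} {k : ℕ} {w v : List A} (hw : Phased ph p w)
    (hv : v ∈ realPow (phaseSubst ph) k w) : Phased ph p v := by
  induction k generalizing w with
  | zero =>
    obtain rfl : v = w := hv
    exact hw
  | succ k ih =>
    simp only [realPow, Set.mem_iUnion] at hv
    obtain ⟨u, hu, hv⟩ := hv
    exact ih (phased_of_mem_real hw hu) hv

theorem mem_real_of_phased {p : ZMod b} {w v : List A} (hw : Phased ph p w)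
    (hv : Phased ph p v) (hl : v.length = (b + 1) * w.length) :
    v ∈ real (phaseSubst ph) w := by
  induction w generalizing p v with
  | nil => exact List.length_eq_zero_iff.1 (by simpa using hl)
  | cons a w ih =>
    obtain ⟨rfl, hw⟩ := hw
    rw [List.length_cons, mul_add, mul_one] at hl
    have hlen : (v.take (b + 1)).length = b + 1 := by
      rw [List.length_take]; omega
    rw [← List.take_append_drop (b + 1) v, phased_append, hlen] at hv
    refine ⟨v.take (b + 1), ⟨hlen, hv.1⟩, v.drop (b + 1), ih hw ?_ ?_,
      (List.take_append_drop _ _).symm⟩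
    · simpa using hv.2
    · rw [List.length_drop]; omega

theorem mem_realPow_of_phased (hs : Function.Surjective ph) {p : ZMod b} {k : ℕ}
    {w v : List A} (hw : Phased ph p w) (hv : Phased ph p v)
    (hl : v.length = (b + 1) ^ (k + 1) * w.length) :
    v ∈ realPow (phaseSubst ph) (k + 1) w := by
  induction k generalizing w with
  | zero =>
    simp only [realPow, Set.mem_iUnion]
    exact ⟨v, mem_real_of_phased hw hv (by simpa using hl), rfl⟩
  | succ k ih =>
    obtain ⟨u, hul, hu⟩ := exists_phased hs p ((b + 1) * w.length)
    rw [realPow, Set.mem_iUnion₂]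
    exact ⟨u, mem_real_of_phased hw hu hul, ih hu (by rw [hl, hul]; ring)⟩

theorem exists_phased_of_legal {u : List A} (hu : Legal (phaseSubst ph) u) :
    ∃ p, Phased ph p u := by
  obtain ⟨k, a, v, hv, s, t, rfl⟩ := hu
  have h := phased_of_mem_realPow (p := ph a) (w := [a]) ⟨rfl, trivial⟩ hv
  exact ⟨_, (phased_append.1 (phased_append.1 h).1).2⟩

theorem legal_of_phased [NeZero b] (hs : Function.Surjective ph) {p : ZMod b} {u : List A}
    (hu : Phased ph p u) : Legal (phaseSubst ph) u := by
  obtain ⟨a, rfl⟩ := hs p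
  have hle : u.length ≤ (b + 1) ^ (u.length + 1) :=
    (Nat.le_succ _).trans (Nat.lt_pow_self (by have := NeZero.pos b; omega)).le
  obtain ⟨t, htl, ht⟩ :=
    exists_phased hs (ph a + u.length) ((b + 1) ^ (u.length + 1) - u.length)
  refine ⟨u.length + 1, a, u ++ t, mem_realPow_of_phased hs (p := ph a) ⟨rfl, trivial⟩
    (phased_append.2 ⟨hu, ht⟩) ?_, ⟨[], t, rfl⟩⟩
  rw [List.length_append, htl, List.length_singleton, mul_one]
  omega

theorem isRandomSubst_phaseSubst [Finite A] (hs : Function.Surjective ph) :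
    IsRandomSubst (phaseSubst ph) := by
  refine fun a => ⟨exists_phased hs _ _,
    (List.finite_length_eq A (b + 1)).subset fun u hu => hu.1, ?_⟩
  rintro u ⟨hu, -⟩ rfl
  simp at hu

theorem primitive_phaseSubst [NeZero b] (hs : Function.Surjective ph) :
    Primitive (phaseSubst ph) := by
  refine ⟨1, fun a c => ?_⟩
  have hj := ZMod.val_lt (ph a - ph c)
  obtain ⟨u, hul, hu⟩ := exists_phased hs (ph c) (ph a - ph c).val
  obtain ⟨v, hvl, hv⟩ := exists_phased hs (ph a + 1) (b - (ph a - ph c).val)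
  refine ⟨u ++ a :: v, mem_realPow_of_phased hs (p := ph c) ⟨rfl, trivial⟩
    (phased_append.2 ⟨hu, ?_, ?_⟩) ?_, by simp⟩
  · simp [hul]
  · simpa [hul] using hv
  · simp only [List.length_append, List.length_cons, hul, hvl, List.length_nil]
    simp only [zero_add, pow_one, mul_one]
    omega

theorem mem_X_of_phase [NeZero b] (hs : Function.Surjective ph) {x : ℤ → A}
    (hx : ∀ i, ph (x i) = i) : x ∈ X (phaseSubst ph) :=
  fun i _ => legal_of_phased hs (p := i) (phased_ofFn.2 fun j => by simp [hx])

theorem X_phaseSubst_nonempty [NeZero b] (hs : Function.Surjective ph) :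
    (X (phaseSubst ph)).Nonempty := by
  obtain ⟨s, hs'⟩ := hs.hasRightInverse
  exact ⟨fun i => s i, mem_X_of_phase hs fun i => hs' _⟩

theorem lang_subset_phasedWords (n : ℕ) :
    lang (X (phaseSubst ph)) n ⊆ ⋃ p, phasedWords ph p n := by
  rintro u ⟨hu, x, hx, i, rfl⟩
  obtain ⟨p, hp⟩ := exists_phased_of_legal (hx i n)
  exact Set.mem_iUnion.2 ⟨p, hu, hp⟩

theorem phasedWords_subset_lang [NeZero b] (hs : Function.Surjective ph) (n : ℕ) :
    phasedWords ph 0 n ⊆ lang (X (phaseSubst ph)) n := by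
  rintro u ⟨rfl, hu⟩
  obtain ⟨s, hs'⟩ := hs.hasRightInverse
  refine ⟨rfl, fun i => if h : 0 ≤ i ∧ i.toNat < u.length then u[i.toNat]'h.2 else s i,
    mem_X_of_phase hs fun i => ?_, 0, ?_⟩
  · split_ifs with h
    · rw [hu.getElem, zero_add, ← Int.cast_natCast, Int.toNat_of_nonneg h.1]
    · exact hs' _
  · simp [subwordAt]

theorem finite_phasedWords [Finite A] (p : ZMod b) (n : ℕ) : (phasedWords ph p n).Finite :=
  (List.finite_length_eq A n).subset fun _ hu => hu.1

theorem ncard_phasedWords (p : ZMod b) (n : ℕ) :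
    (phasedWords ph p n).ncard = ∏ j ∈ Finset.range n, (ph ⁻¹' {p + (j : ZMod b)}).ncard := by
  induction n generalizing p with
  | zero =>
    have : phasedWords ph p 0 = {[]} := by
      ext u
      constructor
      · exact fun hu => List.length_eq_zero_iff.1 hu.1
      · rintro rfl
        exact ⟨rfl, trivial⟩
    simp [this]
  | succ n ih =>
    have : phasedWords ph p (n + 1) =
        (fun x : A × List A => x.1 :: x.2) '' ((ph ⁻¹' {p}) ×ˢ phasedWords ph (p + 1) n) := by
      ext u
      constructor
      · rintro ⟨hl, hu⟩
        cases u with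
        | nil => simp at hl
        | cons a u => exact ⟨(a, u), ⟨hu.1, by simpa using hl, hu.2⟩, rfl⟩
      · rintro ⟨⟨a, u⟩, ⟨ha, hl, hu⟩, rfl⟩
        exact ⟨by simpa using hl, ha, hu⟩
    rw [this, Set.ncard_image_of_injective, Set.ncard_prod, ih, Finset.prod_range_succ',
      mul_comm]
    · simp [add_assoc, add_comm (1 : ZMod b)]
    · rintro ⟨a, u⟩ ⟨a', u'⟩ h
      simpa using h

end Phase

section Product

variable {b : ℕ} [NeZero b]

theorem prod_range_zmod (c : ZMod b → ℕ) (p : ZMod b) :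
    ∏ j ∈ Finset.range b, c (p + (j : ZMod b)) = ∏ x, c x := by
  refine Finset.prod_nbij (fun j : ℕ => p + (j : ZMod b)) (by simp) ?_ ?_ (by simp)
  · intro i hi j hj h
    have h' := congrArg ZMod.val (add_left_cancel h)
    rwa [ZMod.val_cast_of_lt (by simpa using hi), ZMod.val_cast_of_lt (by simpa using hj)] at h'
  · intro x _
    exact ⟨(x - p).val, by simpa using ZMod.val_lt _, by simp⟩

theorem prod_range_zmod_mul_add (c : ZMod b → ℕ) (p : ZMod b) (k r : ℕ) :
    ∏ j ∈ Finset.range (b * k + r), c (p + (j : ZMod b)) =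
      (∏ x, c x) ^ k * ∏ j ∈ Finset.range r, c (p + (j : ZMod b)) := by
  induction k with
  | zero => simp
  | succ k ih =>
    rw [mul_add, mul_one, add_right_comm, add_comm, Finset.prod_range_add, prod_range_zmod]
    simp only [Nat.cast_add, CharP.cast_eq_zero, zero_add]
    rw [ih]
    ring

theorem pow_le_prod_range_zmod {c : ZMod b → ℕ} (hc : ∀ x, 1 ≤ c x) (p : ZMod b) (n : ℕ) :
    (∏ x, c x) ^ (n / b) ≤ ∏ j ∈ Finset.range n, c (p + (j : ZMod b)) := by
  conv_rhs => rw [← Nat.div_add_mod n b, prod_range_zmod_mul_add]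
  exact Nat.le_mul_of_pos_right _ (Finset.prod_pos fun _ _ => hc _)

theorem prod_range_zmod_le_pow {c : ZMod b → ℕ} (hc : ∀ x, 1 ≤ c x) (p : ZMod b) (n : ℕ) :
    ∏ j ∈ Finset.range n, c (p + (j : ZMod b)) ≤ (∏ x, c x) ^ (n / b + 1) := by
  conv_lhs => rw [← Nat.div_add_mod n b, prod_range_zmod_mul_add]
  rw [pow_succ]
  refine Nat.mul_le_mul_left _ ?_
  rw [← prod_range_zmod c p]
  exact Finset.prod_le_prod_of_subset_of_one_le'
    (Finset.range_mono (Nat.mod_lt _ (NeZero.pos b)).le) fun _ _ _ => hc _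

end Product

theorem entropy_X_phaseSubst {A : Type*} [Finite A] {b : ℕ} [NeZero b] {ph : A → ZMod b}
    (hs : Function.Surjective ph) :
    entropy (X (phaseSubst ph)) = Real.log (∏ p, ((ph ⁻¹' {p}).ncard : ℝ)) / b := by
  set c : ZMod b → ℕ := fun p => (ph ⁻¹' {p}).ncard
  have hc : ∀ p, 1 ≤ c p := fun p =>
    Nat.one_le_iff_ne_zero.2 ((Set.ncard_pos (Set.toFinite _)).2 (hs p)).ne'
  set m : ℕ := ∏ p, c p
  have hm1 : 1 ≤ m := Nat.one_le_iff_ne_zero.2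
    (Finset.prod_ne_zero_iff.2 fun p _ => Nat.one_le_iff_ne_zero.1 (hc p))
  have hb : (0 : ℝ) < b := Nat.cast_pos.2 (NeZero.pos b)
  set N : ℕ → ℕ := fun n => (lang (X (phaseSubst ph)) n).ncard
  have hlow : ∀ n, m ^ (n / b) ≤ N n := fun n => by
    refine (pow_le_prod_range_zmod hc 0 n).trans ?_
    rw [← ncard_phasedWords]
    exact Set.ncard_le_ncard (phasedWords_subset_lang hs n)
      ((List.finite_length_eq A n).subset fun _ hu => hu.1)
  have hup : ∀ n, N n ≤ b * m ^ (n / b + 1) := fun n => by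
    calc N n ≤ (⋃ p, phasedWords ph p n).ncard :=
          Set.ncard_le_ncard (lang_subset_phasedWords n)
            (Set.finite_iUnion fun p => finite_phasedWords p n)
      _ ≤ ∑ p, (phasedWords ph p n).ncard := Set.ncard_iUnion_le_of_fintype _
      _ ≤ ∑ _p : ZMod b, m ^ (n / b + 1) := Finset.sum_le_sum fun p _ => by
          rw [ncard_phasedWords]
          exact prod_range_zmod_le_pow hc p n
      _ = b * m ^ (n / b + 1) := by simp [ZMod.card]
  have hL : 0 ≤ Real.log m := Real.log_natCast_nonneg m
  have hm0 : (0 : ℝ) < m := Nat.cast_pos.2 hm1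
  have hbound : ∀ n : ℕ, |Real.log (N n) - n * (Real.log m / b)| ≤ Real.log b + Real.log m := by
    intro n
    have hN0 : (0 : ℝ) < N n := Nat.cast_pos.2 ((Nat.pow_pos hm1).trans_le (hlow n))
    have h1 : ((n / b : ℕ) : ℝ) * Real.log m ≤ Real.log (N n) := by
      rw [← Real.log_pow]
      exact Real.log_le_log (by positivity) (by exact_mod_cast hlow n)
    have h2 : Real.log (N n) ≤ Real.log b + ((n / b : ℕ) + 1) * Real.log m := by
      have h := Real.log_le_log hN0 (show (N n : ℝ) ≤ b * (m : ℝ) ^ (n / b + 1) by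
        exact_mod_cast hup n)
      rwa [Real.log_mul hb.ne' (by positivity), Real.log_pow, Nat.cast_add_one] at h
    have h3 : ((n / b : ℕ) : ℝ) * Real.log m ≤ n * (Real.log m / b) := by
      rw [mul_div_left_comm, mul_comm]
      exact mul_le_mul_of_nonneg_left Nat.cast_div_le hL
    have h4 : n * (Real.log m / b) ≤ ((n / b : ℕ) + 1) * Real.log m := by
      rw [mul_div_left_comm, mul_comm]
      refine mul_le_mul_of_nonneg_right ?_ hL
      rw [div_le_iff₀ hb]
      have h := (Nat.lt_div_mul_add (a := n) (NeZero.pos b)).le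
      rw [← Nat.succ_mul] at h
      exact_mod_cast h
    have h5 := Real.log_natCast_nonneg b
    rw [abs_le]
    constructor <;> linarith
  have herr : Tendsto (fun n : ℕ => (Real.log (N n) - n * (Real.log m / b)) / n) atTop (𝓝 0) := by
    refine squeeze_zero_norm (fun n => ?_)
      (tendsto_const_div_atTop_nhds_zero_nat (Real.log b + Real.log m))
    rw [Real.norm_eq_abs, abs_div, Nat.abs_cast]
    exact div_le_div_of_nonneg_right (hbound n) n.cast_nonneg
  have hlim : Tendsto (fun n : ℕ => Real.log (N n) / n) atTop (𝓝 (Real.log m / b)) := by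
    have h := herr.add_const (Real.log m / b)
    rw [zero_add] at h
    refine h.congr' ?_
    filter_upwards [eventually_ne_atTop 0] with n hn
    have : (n : ℝ) ≠ 0 := Nat.cast_ne_zero.2 hn
    field_simp
    ring
  rw [← Nat.cast_prod]
  exact hlim.limsup_eq

end RS

/-- For every nonnegative rational `q` there is a primitive random substitution
on some finite alphabet, with nonempty RS-subshift, whose topological entropy is `q log 2`. -/
theorem stmt19 (q : ℚ) (hq : 0 ≤ q) :
    ∃ (n : ℕ) (θ : Fin n → Set (List (Fin n))),
      RS.IsRandomSubst θ ∧ RS.Primitive θ ∧ (RS.X θ).Nonempty ∧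
      RS.entropy (RS.X θ) = (q : ℝ) * Real.log 2 := by
  have : NeZero q.den := ⟨q.den_nz⟩
  let c : ZMod q.den → ℕ := fun p => if p = 0 then 2 ^ q.num.toNat else 1
  have hc : ∀ p, 0 < c p := fun p => by
    dsimp only [c]
    split_ifs <;> positivity
  let e := Fintype.equivFin (Σ p, Fin (c p))
  let ph : Fin (Fintype.card (Σ p, Fin (c p))) → ZMod q.den := fun x => (e.symm x).1
  have hs : Function.Surjective ph := fun p => ⟨e ⟨p, 0, hc p⟩, by simp [ph]⟩
  have hfiber : ∀ p, (ph ⁻¹' {p}).ncard = c p := fun p => by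
    have : ph ⁻¹' {p} = Set.range fun i : Fin (c p) => e ⟨p, i⟩ := by
      ext x
      obtain ⟨⟨p', i⟩, rfl⟩ := e.surjective x
      simp only [Set.mem_preimage, Set.mem_singleton_iff, Set.mem_range, ph,
        Equiv.symm_apply_apply, EmbeddingLike.apply_eq_iff_eq]
      constructor
      · rintro rfl
        exact ⟨i, rfl⟩
      · rintro ⟨j, hj⟩
        exact (congrArg Sigma.fst hj).symm
    rw [this, ← Set.image_univ, Set.ncard_image_of_injective _
      fun i j h => sigma_mk_injective (e.injective h), Set.ncard_univ, Nat.card_fin]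
  refine ⟨_, RS.phaseSubst ph, RS.isRandomSubst_phaseSubst hs, RS.primitive_phaseSubst hs,
    RS.X_phaseSubst_nonempty hs, ?_⟩
  rw [RS.entropy_X_phaseSubst hs]
  have hprod : ∏ p, ((ph ⁻¹' {p}).ncard : ℝ) = 2 ^ q.num.toNat := by
    simp only [hfiber, ← Nat.cast_prod]
    simp [c]
  have hnum : ((q.num.toNat : ℕ) : ℝ) = (q.num : ℝ) := by
    exact_mod_cast Int.toNat_of_nonneg (Rat.num_nonneg.2 hq)
  rw [hprod, Real.log_pow, hnum, Rat.cast_def, mul_div_right_comm]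
end
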